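/- arXiv:1401.7301 — 4 statements merged into one kernel-verified Lean document; each statement's English description precedes it below -/
import Mathlib

section
/- Let M be a loopless matroid of rank r ≥ 2 on E = {1,…,n}, with vectors e_1,…,e_n ∈ ℝ^{n−1} as in the Bergman fan construction. Let C be a maximal chain of proper nonempty flats of M (so C consists of r−1 flats, one of each rank 1,…,r−1), and let F ∈ C. Then the sum Σ_G e_G, taken over all proper nonempty flats G of M such that (C ∖ {F}) ∪ {G} is again a maximal chain of proper nonempty flats, lies in the ℝ-linear span of the vectors {e_H : H ∈ C ∖ {F}}. -/
open Function

noncomputable section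

/-- The rank function of a matroid: the largest cardinality of an independent subset of `X`. -/
def mrk {n : ℕ} (M : Matroid (Fin n)) (X : Set (Fin n)) : ℕ :=
  sSup {k | ∃ I, M.Indep I ∧ I ⊆ X ∧ I.ncard = k}

/-- The vector `e_S = Σ_{i ∈ S} e_i` associated to a subset `S` of the ground set. -/
def eVec {n : ℕ} {V : Type*} [AddCommMonoid V] (e : Fin n → V) (S : Set (Fin n)) : V :=
  ∑ᶠ i ∈ S, e i

/-- The proper nonempty flats of a matroid on ground set `Fin n` (with `M.E = univ`). -/
def properFlats {n : ℕ} (M : Matroid (Fin n)) : Set (Set (Fin n)) :=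
  {F | M.closure F = F ∧ F.Nonempty ∧ F ≠ Set.univ}

/-- A maximal chain of proper nonempty flats of `M`. -/
def IsMaximalFlatChain {n : ℕ} (M : Matroid (Fin n)) (C : Set (Set (Fin n))) : Prop :=
  C ⊆ properFlats M ∧ IsChain (· ⊆ ·) C ∧
    ∀ C', C' ⊆ properFlats M → IsChain (· ⊆ ·) C' → C ⊆ C' → C = C'

namespace Matroid

variable {α : Type*} {M : Matroid α} {A F B G X : Set α} {x y f g : α}

/-- Two elements that are independent over `A` and lie in `cl (A ∪ {f, g})` span it over `A`. -/
lemma closure_insert_insert_eq_of_mem (hx : x ∈ M.closure (insert g (insert f A)))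
    (hxA : x ∉ M.closure A) (hy : y ∈ M.closure (insert g (insert f A)))
    (hyA : y ∉ M.closure (insert x A)) :
    M.closure (insert y (insert x A)) = M.closure (insert g (insert f A)) := by
  by_cases hxf : x ∈ M.closure (insert f A)
  · have h1 : M.closure (insert x A) = M.closure (insert f A) :=
      closure_insert_congr ⟨hxf, hxA⟩
    have h2 : M.closure (insert g (insert x A)) = M.closure (insert g (insert f A)) :=
      closure_insert_congr_right h1
    rw [← h2] at hy ⊢
    exact closure_insert_congr ⟨hy, hyA⟩
  · have h1 : M.closure (insert x (insert f A)) = M.closure (insert g (insert f A)) :=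
      closure_insert_congr ⟨hx, hxf⟩
    rw [← h1, Set.insert_comm x f] at hy ⊢
    exact closure_insert_congr ⟨hy, hyA⟩

/-- If no flat lies strictly between `X` and `G`, then `G` is spanned over `X` by any of its
elements outside `X`. -/
lemma closure_insert_eq_of_forall_not_ssubset (hE : M.E = Set.univ)
    (hG : M.closure G = G) (hXG : X ⊆ G)
    (hcov : ∀ Y, M.closure Y = Y → X ⊂ Y → ¬ Y ⊂ G) (hxG : x ∈ G) (hxX : x ∉ X) :
    M.closure (insert x X) = G := by
  have hsub : insert x X ⊆ M.closure (insert x X) :=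
    M.subset_closure _ (hE ▸ Set.subset_univ _)
  have hle : M.closure (insert x X) ⊆ G := by
    rw [← hG]
    exact M.closure_subset_closure (Set.insert_subset hxG hXG)
  by_contra hne
  exact hcov _ (M.closure_closure _)
    ⟨(Set.subset_insert _ _).trans hsub, fun h => hxX (h (hsub (Set.mem_insert _ _)))⟩
    (hle.ssubset_of_ne hne)

/-- If `A ⋖ F ⋖ B` in the lattice of flats, then every chain of flats from `A` to `B` has at most one
interior member. -/
lemma eq_of_ssubset_of_subset_of_ssubset (hE : M.E = Set.univ) (hA : M.closure A = A)
    (hF : M.closure F = F) (hB : M.closure B = B) (hAF : A ⊂ F) (hFB : F ⊂ B)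
    (hcovA : ∀ Y, M.closure Y = Y → A ⊂ Y → ¬ Y ⊂ F)
    (hcovB : ∀ Y, M.closure Y = Y → F ⊂ Y → ¬ Y ⊂ B)
    (hX : M.closure X = X) (hG : M.closure G = G) (hAX : A ⊂ X) (hXG : X ⊆ G) (hGB : G ⊂ B) :
    X = G := by
  obtain ⟨f, hfF, hfA⟩ := Set.exists_of_ssubset hAF
  obtain ⟨g, hgB, hgF⟩ := Set.exists_of_ssubset hFB
  obtain ⟨x, hxX, hxA⟩ := Set.exists_of_ssubset hAX
  have hFe := closure_insert_eq_of_forall_not_ssubset hE hF hAF.subset hcovA hfF hfA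
  have hBe := closure_insert_eq_of_forall_not_ssubset hE hB hFB.subset hcovB hgB hgF
  rw [← hFe, closure_insert_closure_eq_closure_insert] at hBe
  refine hXG.antisymm fun y hyG => ?_
  by_contra hyX
  have hxG := hXG hxX
  have hy : y ∉ M.closure (insert x A) := fun h =>
    hyX (hX ▸ M.closure_subset_closure (Set.insert_subset hxX hAX.subset) h)
  have key : M.closure (insert y (insert x A)) = B :=
    (closure_insert_insert_eq_of_mem (hBe ▸ hGB.subset hxG) (hA.symm ▸ hxA)
      (hBe ▸ hGB.subset hyG) hy).trans hBe
  refine hGB.not_subset ?_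
  rw [← key, ← hG]
  exact M.closure_subset_closure
    (Set.insert_subset hyG (Set.insert_subset hxG (hAX.subset.trans hXG)))

/-- If `A ⋖ F ⋖ B` in the lattice of flats, then a single element of `B \ A` does not span `B`
over `A`. -/
lemma closure_insert_ssubset (hA : M.closure A = A)
    (hF : M.closure F = F) (hB : M.closure B = B) (hAF : A ⊂ F) (hFB : F ⊂ B)
    (hxB : x ∈ B) : M.closure (insert x A) ⊂ B := by
  obtain ⟨f, hfF, hfA⟩ := Set.exists_of_ssubset hAF
  have hle : M.closure (insert x A) ⊆ B := by
    rw [← hB]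
    exact M.closure_subset_closure (Set.insert_subset hxB (hAF.subset.trans hFB.subset))
  refine hle.ssubset_of_ne fun h => hFB.not_subset ?_
  have h1 : M.closure (insert f A) = M.closure (insert x A) :=
    closure_insert_congr ⟨h.symm ▸ hFB.subset hfF, hA.symm ▸ hfA⟩
  rw [← h, ← h1, ← hF]
  exact M.closure_subset_closure (Set.insert_subset hfF hAF.subset)

end Matroid

section BergmanFan

variable {n : ℕ} {M : Matroid (Fin n)} {C : Set (Set (Fin n))} {A F B G X : Set (Fin n)}

/-- A proper nonempty flat comparable to all members of a maximal chain belongs to it. -/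
lemma IsMaximalFlatChain.mem_of_forall_comparable (hC : IsMaximalFlatChain M C)
    (hX : X ∈ properFlats M) (h : ∀ H ∈ C, X ⊆ H ∨ H ⊆ X) : X ∈ C := by
  rw [hC.2.2 (insert X C) (Set.insert_subset hX hC.1)
    (hC.2.1.insert fun H hH _ => h H hH) (Set.subset_insert _ _)]
  exact Set.mem_insert _ _

lemma IsMaximalFlatChain.exists_lower (hC : IsMaximalFlatChain M C) (hF : F ∈ C) :
    ∃ A, (A = ∅ ∨ A ∈ C \ {F}) ∧ A ⊂ F ∧ ∀ H ∈ C, H ⊂ F → H ⊆ A := by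
  rcases Set.eq_empty_or_nonempty {H | H ∈ C ∧ H ⊂ F} with h | h
  · refine ⟨∅, Or.inl rfl, Set.empty_ssubset.2 (hC.1 hF).2.1, fun H hH hHF => ?_⟩
    exact absurd (show H ∈ {H | H ∈ C ∧ H ⊂ F} from ⟨hH, hHF⟩) (h ▸ Set.notMem_empty H)
  · obtain ⟨A, hA⟩ := (Set.toFinite {H | H ∈ C ∧ H ⊂ F}).exists_maximal h
    refine ⟨A, Or.inr ⟨hA.prop.1, hA.prop.2.ne⟩, hA.prop.2, fun H hH hHF => ?_⟩
    exact (hC.2.1.total hH hA.prop.1).elim id fun hAH => hA.le_of_ge ⟨hH, hHF⟩ hAH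

lemma IsMaximalFlatChain.exists_upper (hC : IsMaximalFlatChain M C) (hF : F ∈ C) :
    ∃ B, (B = Set.univ ∨ B ∈ C \ {F}) ∧ F ⊂ B ∧ ∀ H ∈ C, F ⊂ H → B ⊆ H := by
  rcases Set.eq_empty_or_nonempty {H | H ∈ C ∧ F ⊂ H} with h | h
  · refine ⟨Set.univ, Or.inl rfl, Set.ssubset_univ_iff.2 (hC.1 hF).2.2, fun H hH hHF => ?_⟩
    exact absurd (show H ∈ {H | H ∈ C ∧ F ⊂ H} from ⟨hH, hHF⟩) (h ▸ Set.notMem_empty H)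
  · obtain ⟨B, hB⟩ := (Set.toFinite {H | H ∈ C ∧ F ⊂ H}).exists_minimal h
    refine ⟨B, Or.inr ⟨hB.prop.1, hB.prop.2.ne'⟩, hB.prop.2, fun H hH hHF => ?_⟩
    exact (hC.2.1.total hB.prop.1 hH).elim id fun hAH => hB.le_of_le ⟨hH, hHF⟩ hAH

/-- The flats that can replace `F` in a maximal chain are those strictly between its neighbours
`A` and `B`. -/
lemma IsMaximalFlatChain.replace_iff (hC : IsMaximalFlatChain M C) (hF : F ∈ C)
    (hAC : A = ∅ ∨ A ∈ C \ {F}) (hAF : A ⊂ F) (hA : ∀ H ∈ C, H ⊂ F → H ⊆ A)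
    (hBC : B = Set.univ ∨ B ∈ C \ {F}) (hFB : F ⊂ B) (hB : ∀ H ∈ C, F ⊂ H → B ⊆ H)
    (hint : ∀ X G, M.closure X = X → M.closure G = G → A ⊂ X → X ⊆ G → G ⊂ B → X = G) :
    (G ∈ properFlats M ∧ IsMaximalFlatChain M ((C \ {F}) ∪ {G})) ↔
      M.closure G = G ∧ A ⊂ G ∧ G ⊂ B := by
  have hsplit : ∀ H ∈ C \ {F}, H ⊆ A ∨ B ⊆ H := fun H hH =>
    (hC.2.1.total hH.1 hF).imp (fun h => hA H hH.1 (h.ssubset_of_ne hH.2))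
      fun h => hB H hH.1 (h.ssubset_of_ne (Ne.symm hH.2))
  constructor
  · rintro ⟨hG, hmax⟩
    have hFmem : (∀ H ∈ (C \ {F}) ∪ {G}, F ⊆ H ∨ H ⊆ F) → F = G := fun h =>
      (hmax.mem_of_forall_comparable (hC.1 hF) h).elim (fun h => absurd rfl h.2) id
    have hFC : ∀ H ∈ C \ {F}, F ⊆ H ∨ H ⊆ F := fun H hH => hC.2.1.total hF hH.1
    have hcomp : G ⊆ F ∨ F ⊆ G → F = G := fun h => hFmem fun H hH =>
      hH.elim (hFC H) fun hHG => by
        rw [Set.mem_singleton_iff.1 hHG]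
        exact h.symm
    have hGt : ∀ H ∈ C \ {F}, G ⊆ H ∨ H ⊆ G := fun H hH =>
      hmax.2.1.total (Or.inr rfl) (Or.inl hH)
    have hGA : ¬ G ⊆ A := fun h =>
      hAF.not_subset (by rwa [hcomp (Or.inl (h.trans hAF.subset))])
    have hGB : ¬ B ⊆ G := fun h =>
      hFB.not_subset (by rwa [hcomp (Or.inr (hFB.subset.trans h))])
    refine ⟨hG.1, ⟨?_, hGA⟩, ⟨?_, hGB⟩⟩
    · rcases hAC with rfl | hAC
      · exact Set.empty_subset _
      · exact (hGt A hAC).resolve_left hGA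
    · rcases hBC with rfl | hBC
      · exact Set.subset_univ _
      · exact (hGt B hBC).resolve_right hGB
  · rintro ⟨hG, hAG, hGB⟩
    have hGp : G ∈ properFlats M :=
      ⟨hG, Set.nonempty_of_ssubset' hAG,
        Set.ssubset_univ_iff.1 (hGB.trans_subset (Set.subset_univ _))⟩
    refine ⟨hGp, Set.union_subset (Set.sdiff_subset.trans hC.1) (Set.singleton_subset_iff.2 hGp),
      ?_, fun C' hC' hchain hsub => hsub.antisymm fun X hX => ?_⟩
    · rw [Set.union_singleton]
      exact (hC.2.1.mono Set.sdiff_subset).insert fun H hH _ =>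
        (hsplit H hH).symm.imp hGB.subset.trans fun h => h.trans hAG.subset
    · have hXt : ∀ H ∈ C', X ⊆ H ∨ H ⊆ X := fun H hH => hchain.total hX hH
      have hXC : X ⊆ F ∨ F ⊆ X → X ∈ C := fun h =>
        hC.mem_of_forall_comparable (hC' hX) fun H hH => by
          by_cases hHF : H = F
          · rwa [hHF]
          · exact hXt H (hsub (Or.inl ⟨hH, hHF⟩))
      by_cases hXA : X ⊆ A
      · exact Or.inl ⟨hXC (Or.inl (hXA.trans hAF.subset)), fun h =>
          hAF.not_subset (Set.mem_singleton_iff.1 h ▸ hXA)⟩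
      by_cases hXB : B ⊆ X
      · exact Or.inl ⟨hXC (Or.inr (hFB.subset.trans hXB)), fun h =>
          hFB.not_subset (Set.mem_singleton_iff.1 h ▸ hXB)⟩
      have hAX : A ⊂ X := by
        refine ⟨?_, hXA⟩
        rcases hAC with rfl | hAC
        · exact Set.empty_subset _
        · exact (hXt A (hsub (Or.inl hAC))).resolve_left hXA
      have hXB' : X ⊂ B := by
        refine ⟨?_, hXB⟩
        rcases hBC with rfl | hBC
        · exact Set.subset_univ _
        · exact (hXt B (hsub (Or.inl hBC))).resolve_right hXB
      right
      rcases hXt G (hsub (Or.inr rfl)) with h | h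
      · exact hint X G (hC' hX).1 hG hAX h hGB
      · exact (hint G X hG (hC' hX).1 hAG h hXB').symm

lemma eVec_eq_add_diff {V : Type*} [AddCommMonoid V] (e : Fin n → V) (h : A ⊆ G) :
    eVec e G = eVec e A + eVec e (G \ A) := by
  unfold eVec
  rw [← finsum_mem_union Set.disjoint_sdiff_right (Set.toFinite _) (Set.toFinite _),
    Set.union_sdiff_cancel h]

/-- If the sets `G \ A`, for `G ∈ S`, partition `B \ A`, then the sum of the `e_G` is
`|S| • e_A + e_{B \ A}`. -/
lemma finsum_mem_eVec_eq {V : Type*} [AddCommMonoid V] (e : Fin n → V) {S : Set (Set (Fin n))}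
    (hA : ∀ G ∈ S, A ⊆ G) (hB : ∀ G ∈ S, G ⊆ B)
    (hS : ∀ x ∈ B \ A, ∃! G, G ∈ S ∧ x ∈ G) :
    ∑ᶠ G ∈ S, eVec e G = S.ncard • eVec e A + eVec e (B \ A) := by
  have hU : B \ A = ⋃ G ∈ S, G \ A := by
    ext x
    simp only [Set.mem_iUnion, exists_prop]
    constructor
    · intro hx
      obtain ⟨G, ⟨hG, hxG⟩, -⟩ := hS x hx
      exact ⟨G, hG, hxG, hx.2⟩
    · rintro ⟨G, hG, hxG, hxA⟩
      exact ⟨hB G hG hxG, hxA⟩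
  have hdisj : S.PairwiseDisjoint fun G => G \ A := fun G hG G' hG' hne =>
    Set.disjoint_left.2 fun x hx hx' => hne <|
      (hS x ⟨hB G hG hx.1, hx.2⟩).unique ⟨hG, hx.1⟩ ⟨hG', hx'.1⟩
  have hsum : eVec e (B \ A) = ∑ᶠ G ∈ S, eVec e (G \ A) := by
    unfold eVec
    rw [hU, finsum_mem_biUnion hdisj (Set.toFinite _) fun _ _ => Set.toFinite _]
  rw [hsum, finsum_mem_congr rfl fun G hG => eVec_eq_add_diff e (hA G hG),
    finsum_mem_add_distrib (Set.toFinite _), finsum_mem_eq_finite_toFinset_sum _ (Set.toFinite S),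
    Finset.sum_const, ← Set.ncard_eq_toFinset_card]

end BergmanFan

/-- **The balancing property of Bergman fans.** Let `C` be a maximal chain of proper
nonempty flats of a loopless matroid `M` of rank `r ≥ 2` and let `F ∈ C`.  Then the
sum of the vectors `e_G`, over all proper nonempty flats `G` for which
`(C \ {F}) ∪ {G}` is again a maximal chain, lies in the linear span of
`{e_H : H ∈ C \ {F}}`. -/
theorem bergmanFan_balancing
    {n r : ℕ} (M : Matroid (Fin n)) (hE : M.E = Set.univ)
    (hLoopless : M.closure ∅ = ∅)
    (hrank : mrk M Set.univ = r) (hr : 2 ≤ r)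
    (e : Fin n → EuclideanSpace ℝ (Fin (n - 1)))
    (hsum : ∑ i, e i = 0)
    (hind : ∀ s : Finset (Fin n), s ≠ Finset.univ →
      LinearIndependent ℝ (fun i : ↥s => e ↑i))
    (C : Set (Set (Fin n))) (hC : IsMaximalFlatChain M C) (F : Set (Fin n)) (hF : F ∈ C) :
    (∑ᶠ G ∈ {G : Set (Fin n) | G ∈ properFlats M ∧
        IsMaximalFlatChain M ((C \ {F}) ∪ {G})}, eVec e G) ∈
      Submodule.span ℝ (eVec e '' (C \ {F})) := by
  obtain ⟨A, hAC, hAF, hA⟩ := hC.exists_lower hF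
  obtain ⟨B, hBC, hFB, hB⟩ := hC.exists_upper hF
  have hFf := (hC.1 hF).1
  have hAf : M.closure A = A := by
    rcases hAC with rfl | h
    exacts [hLoopless, (hC.1 h.1).1]
  have hBf : M.closure B = B := by
    rcases hBC with rfl | h
    exacts [M.closure_univ.trans hE, (hC.1 h.1).1]
  have hmem : ∀ Y, M.closure Y = Y → A ⊂ Y → Y ⊂ B → (Y ⊆ F ∨ F ⊆ Y) → Y ∈ C := by
    intro Y hY hAY hYB hYF
    refine hC.mem_of_forall_comparable ⟨hY, Set.nonempty_of_ssubset' hAY,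
      Set.ssubset_univ_iff.1 (hYB.trans_subset (Set.subset_univ _))⟩ fun H hH => ?_
    rcases eq_or_ne H F with rfl | hne
    · exact hYF
    · rcases hC.2.1.total hH hF with h | h
      · exact Or.inr ((hA H hH (h.ssubset_of_ne hne)).trans hAY.subset)
      · exact Or.inl (hYB.subset.trans (hB H hH (h.ssubset_of_ne hne.symm)))
  have hcovA : ∀ Y, M.closure Y = Y → A ⊂ Y → ¬ Y ⊂ F := fun Y hY hAY hYF =>
    hAY.not_subset (hA Y (hmem Y hY hAY (hYF.trans hFB) (Or.inl hYF.subset)) hYF)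
  have hcovB : ∀ Y, M.closure Y = Y → F ⊂ Y → ¬ Y ⊂ B := fun Y hY hFY hYB =>
    hYB.not_subset (hB Y (hmem Y hY (hAF.trans hFY) hYB (Or.inr hFY.subset)) hFY)
  have hint : ∀ X G, M.closure X = X → M.closure G = G → A ⊂ X → X ⊆ G → G ⊂ B → X = G :=
    fun X G hX hG => Matroid.eq_of_ssubset_of_subset_of_ssubset hE hAf hFf hBf hAF hFB
      hcovA hcovB hX hG
  have hset : {G : Set (Fin n) | G ∈ properFlats M ∧
      IsMaximalFlatChain M ((C \ {F}) ∪ {G})} = {G | M.closure G = G ∧ A ⊂ G ∧ G ⊂ B} :=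
    Set.ext fun G => hC.replace_iff hF hAC hAF hA hBC hFB hB hint
  have hpart : ∀ x ∈ B \ A, ∃! G, G ∈ {G | M.closure G = G ∧ A ⊂ G ∧ G ⊂ B} ∧ x ∈ G := by
    intro x hx
    have hsub : insert x A ⊆ M.closure (insert x A) :=
      M.subset_closure _ (hE ▸ Set.subset_univ _)
    have hxm := hsub (Set.mem_insert x A)
    have hAcl : A ⊂ M.closure (insert x A) :=
      ⟨(Set.subset_insert _ _).trans hsub, fun h => hx.2 (h hxm)⟩
    refine ⟨M.closure (insert x A), ⟨⟨M.closure_closure _, hAcl,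
      Matroid.closure_insert_ssubset hAf hFf hBf hAF hFB hx.1⟩, hxm⟩, ?_⟩
    rintro G ⟨⟨hG, hAG, hGB⟩, hxG⟩
    refine (hint _ G (M.closure_closure _) hG hAcl ?_ hGB).symm
    rw [← hG]
    exact M.closure_subset_closure (Set.insert_subset hxG hAG.subset)
  rw [hset, finsum_mem_eVec_eq e (fun G hG => hG.2.1.subset) (fun G hG => hG.2.2.subset) hpart,
    ← add_sub_cancel_left (eVec e A) (eVec e (B \ A)),
    ← eVec_eq_add_diff e (hAF.subset.trans hFB.subset)]
  have hAs : eVec e A ∈ Submodule.span ℝ (eVec e '' (C \ {F})) := by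
    rcases hAC with rfl | h
    · simp [eVec]
    · exact Submodule.subset_span ⟨A, h, rfl⟩
  have hBs : eVec e B ∈ Submodule.span ℝ (eVec e '' (C \ {F})) := by
    rcases hBC with rfl | h
    · have h0 : eVec e Set.univ = 0 := by
        simpa [eVec, finsum_eq_sum_of_fintype] using hsum
      exact h0 ▸ Submodule.zero_mem _
    · exact Submodule.subset_span ⟨B, h, rfl⟩
  exact add_mem (nsmul_mem hAs _) (sub_mem hBs hAs)
end
end

section
/- Let M be a loopless matroid of rank r on E = {1,…,n}. Then: (i) every chain (with respect to inclusion) of proper spanning subsets of M has at most n−r elements, so the order complex of the poset of proper spanning subsets has dimension at most n−r−1; and (ii) the geometric realization of the order complex of the poset of proper spanning subsets of M is homotopy equivalent to the geometric realization of the order complex of the poset {σ : ∅ ⊊ σ ⊊ E, σ is not a flat of M}, both ordered by inclusion. -/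
open Function

noncomputable section

/-- The geometric realization of the order complex of the subposet `P` of `α`:
points are convex combinations supported on finite chains contained in `P`. -/
def orderComplex {α : Type*} [Preorder α] (P : Set α) : Set (α → ℝ) :=
  {f | (∀ x, 0 ≤ f x) ∧ (Function.support f).Finite ∧ Function.support f ⊆ P ∧
       IsChain (· ≤ ·) (Function.support f) ∧ ∑ᶠ x, f x = 1}

/-- The poset of proper spanning subsets of `M`: sets `σ ⊊ E` with closure `E`. -/
def properSpanning {n : ℕ} (M : Matroid (Fin n)) : Set (Set (Fin n)) :=
  {σ | M.closure σ = Set.univ ∧ σ ≠ Set.univ}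

/-- The poset of proper nonempty non-flats of `M`. -/
def properNonFlats {n : ℕ} (M : Matroid (Fin n)) : Set (Set (Fin n)) :=
  {σ | σ.Nonempty ∧ σ ≠ Set.univ ∧ M.closure σ ≠ σ}

lemma subset_or_subset_of_gap {α : Type*} {x : α → ℝ} {S T : Finset α}
    (hS : ∀ a ∈ S, ∀ b ∉ S, x b < x a) (hT : ∀ a ∈ T, ∀ b ∉ T, x b < x a) : S ⊆ T ∨ T ⊆ S := by
  by_contra! h
  obtain ⟨p, hpS, hpT⟩ := Finset.not_subset.1 h.1
  obtain ⟨q, hqT, hqS⟩ := Finset.not_subset.1 h.2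
  exact (hS p hpS q hqS).asymm (hT q hqT p hpT)

section PrismWeight

variable {α : Type*} [Fintype α]

open Classical in
/-- The part above level `s` of the barycentric weight of `S` at `x`: it is positive exactly when
`x` is larger on `S` than off `S`, and larger than `s` on `S`. -/
def upperWeight (s : ℝ) (x : α → ℝ) (S : Finset α) : ℝ :=
  (∏ a ∈ S, ∏ b ∈ Sᶜ, max 0 (x a - x b)) * ∏ a ∈ S, max 0 (x a - s)

open Classical in
/-- The part below level `s` of the barycentric weight of `S` at `x`: it is positive exactly when
`s` is positive, `x` is larger on `S` than off `S`, positive on `S` and smaller than `s` off `S`. -/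
def lowerWeight (s : ℝ) (x : α → ℝ) (S : Finset α) : ℝ :=
  (∏ a ∈ S, ∏ b ∈ Sᶜ, max 0 (x a - x b)) * ((∏ b ∈ Sᶜ, max 0 (s - x b)) *
    ((∏ a ∈ S, max 0 (x a)) * max 0 s))

lemma upperWeight_nonneg (s : ℝ) (x : α → ℝ) (S : Finset α) : 0 ≤ upperWeight s x S := by
  unfold upperWeight
  positivity

lemma lowerWeight_nonneg (s : ℝ) (x : α → ℝ) (S : Finset α) : 0 ≤ lowerWeight s x S := by
  unfold lowerWeight
  positivity

lemma max_zero_ne_zero_iff {t : ℝ} : max 0 t ≠ 0 ↔ 0 < t := by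
  rw [Ne, max_eq_left_iff, not_le]

lemma upperWeight_ne_zero_iff {s : ℝ} {x : α → ℝ} {S : Finset α} :
    upperWeight s x S ≠ 0 ↔ (∀ a ∈ S, ∀ b ∉ S, x b < x a) ∧ ∀ a ∈ S, s < x a := by
  simp only [upperWeight, mul_ne_zero_iff, Finset.prod_ne_zero_iff, max_zero_ne_zero_iff,
    Finset.mem_compl, sub_pos]

lemma lowerWeight_ne_zero_iff {s : ℝ} {x : α → ℝ} {S : Finset α} :
    lowerWeight s x S ≠ 0 ↔ (∀ a ∈ S, ∀ b ∉ S, x b < x a) ∧ (∀ b ∉ S, x b < s) ∧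
      (∀ a ∈ S, 0 < x a) ∧ 0 < s := by
  simp only [lowerWeight, mul_ne_zero_iff, Finset.prod_ne_zero_iff, max_zero_ne_zero_iff,
    Finset.mem_compl, sub_pos]

open Classical in
/-- Send the part of the mass of `x` below level `s` along `a` and the part above along `b`. -/
def prismWeight (a b : Finset α → α) (s : ℝ) (x : α → ℝ) (p : α) : ℝ :=
  ∑ S : Finset α with S.Nonempty, ((if a S = p then lowerWeight s x S else 0) +
    if b S = p then upperWeight s x S else 0)

lemma continuous_prismWeight {Y : Type*} [TopologicalSpace Y] (a b : Finset α → α) {f : Y → ℝ}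
    {g : Y → α → ℝ} (hf : Continuous f) (hg : Continuous g) :
    Continuous fun y => prismWeight a b (f y) (g y) := by
  refine continuous_pi fun p => continuous_finsetSum _ fun S _ => ?_
  unfold lowerWeight upperWeight
  refine Continuous.add ?_ ?_ <;> split_ifs <;> fun_prop

lemma prismWeight_ne_zero_iff {a b : Finset α → α} {s : ℝ} {x : α → ℝ} {p : α} :
    prismWeight a b s x p ≠ 0 ↔ ∃ S : Finset α, S.Nonempty ∧
      ((a S = p ∧ lowerWeight s x S ≠ 0) ∨ (b S = p ∧ upperWeight s x S ≠ 0)) := by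
  have hl := lowerWeight_nonneg s x
  have hu := upperWeight_nonneg s x
  rw [prismWeight, Ne, Finset.sum_eq_zero_iff_of_nonneg fun S _ =>
    add_nonneg (by split_ifs <;> simp [hl]) (by split_ifs <;> simp [hu])]
  simp only [Finset.mem_filter, Finset.mem_univ, true_and, not_forall, exists_prop]
  refine exists_congr fun S => and_congr_right fun _ => ?_
  rw [add_eq_zero_iff_of_nonneg (by split_ifs <;> simp [hl]) (by split_ifs <;> simp [hu])]
  split_ifs <;> simp [*, imp_iff_not_or]

lemma prismWeight_zero (a a' b : Finset α → α) (x : α → ℝ) :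
    prismWeight a b 0 x = prismWeight a' b 0 x := by
  have h : ∀ S, lowerWeight 0 x S = 0 := fun S => by simp [lowerWeight]
  funext p
  simp [prismWeight, h]

/-- The finsets carrying mass at `x` are contained in the support of `x`. -/
lemma exists_subset_support_of_prismWeight_ne_zero {a b : Finset α → α} {s : ℝ} (hs : 0 ≤ s)
    {x : α → ℝ} {p : α} (h : prismWeight a b s x p ≠ 0) :
    ∃ S : Finset α, S.Nonempty ∧ (S : Set α) ⊆ support x ∧ (a S = p ∨ b S = p) := by
  obtain ⟨S, hne, ⟨hp, hw⟩ | ⟨hp, hw⟩⟩ := prismWeight_ne_zero_iff.1 h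
  · exact ⟨S, hne, fun q hq => ((lowerWeight_ne_zero_iff.1 hw).2.2.1 q hq).ne', Or.inl hp⟩
  · exact ⟨S, hne, fun q hq => (hs.trans_lt ((upperWeight_ne_zero_iff.1 hw).2 q hq)).ne',
      Or.inr hp⟩

end PrismWeight

section Realization

variable {α Y : Type*} [Fintype α] [PartialOrder α] [TopologicalSpace Y]

/-- Unnormalized barycentric coordinates of a point of the order complex of `P`. -/
structure IsWeight (P : Set α) (w : α → ℝ) : Prop where
  nonneg : ∀ p, 0 ≤ w p
  support_subset : support w ⊆ P
  chain : IsChain (· ≤ ·) (support w)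
  exists_ne : ∃ p, w p ≠ 0

lemma IsWeight.sum_pos {P : Set α} {w : α → ℝ} (h : IsWeight P w) : 0 < ∑ p, w p := by
  obtain ⟨p, hp⟩ := h.exists_ne
  exact Finset.sum_pos' (fun q _ => h.nonneg q)
    ⟨p, Finset.mem_univ p, lt_of_le_of_ne (h.nonneg p) hp.symm⟩

lemma sum_eq_one_of_mem_orderComplex {P : Set α} {f : α → ℝ} (hf : f ∈ orderComplex P) :
    ∑ p, f p = 1 := by
  rw [← finsum_eq_sum_of_fintype]
  exact hf.2.2.2.2

lemma isWeight_of_mem_orderComplex {P : Set α} {f : α → ℝ} (hf : f ∈ orderComplex P) :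
    IsWeight P f where
  nonneg := hf.1
  support_subset := hf.2.2.1
  chain := hf.2.2.2.1
  exists_ne := by
    by_contra! h
    simpa [h] using sum_eq_one_of_mem_orderComplex hf

lemma IsWeight.support_div {P : Set α} {w : α → ℝ} (h : IsWeight P w) :
    support (fun p => w p / ∑ q, w q) = support w := by
  ext p
  simp [h.sum_pos.ne']

lemma IsWeight.normalize_mem {P : Set α} {w : α → ℝ} (h : IsWeight P w) :
    (fun p => w p / ∑ q, w q) ∈ orderComplex P := by
  refine ⟨fun p => div_nonneg (h.nonneg p) h.sum_pos.le, Set.toFinite _, ?_, ?_, ?_⟩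
  · rw [h.support_div]
    exact h.support_subset
  · rw [h.support_div]
    exact h.chain
  · rw [finsum_eq_sum_of_fintype, ← Finset.sum_div, div_self h.sum_pos.ne']

/-- The map into an order complex obtained by normalizing a continuous family of weights. -/
def normalizedMap {P : Set α} (W : Y → α → ℝ) (hc : Continuous W) (hW : ∀ y, IsWeight P (W y)) :
    C(Y, orderComplex P) where
  toFun y := ⟨fun p => W y p / ∑ q, W y q, (hW y).normalize_mem⟩
  continuous_toFun := by
    refine Continuous.subtype_mk (continuous_pi fun p => ?_) _
    have hc' := continuous_pi_iff.1 hc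
    exact (hc' p).div (continuous_finsetSum _ fun q _ => hc' q) fun y => (hW y).sum_pos.ne'

lemma support_normalizedMap {P : Set α} (W : Y → α → ℝ) (hc : Continuous W)
    (hW : ∀ y, IsWeight P (W y)) (y : Y) :
    support (normalizedMap W hc hW y : α → ℝ) = support (W y) :=
  (hW y).support_div

/-- A self-map of an order complex which does not enlarge supports is homotopic to the identity,
by a straight-line homotopy. -/
lemma homotopic_id_of_support_subset {P : Set α} (f : C(orderComplex P, orderComplex P))
    (hf : ∀ x, support (f x : α → ℝ) ⊆ support (x : α → ℝ)) :
    f.Homotopic (ContinuousMap.id _) := by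
  let W : unitInterval × orderComplex P → α → ℝ := fun z p =>
    (1 - (z.1 : ℝ)) * (f z.2 : α → ℝ) p + (z.1 : ℝ) * (z.2 : α → ℝ) p
  have hsum : ∀ z, ∑ p, W z p = 1 := fun z => by
    simp only [W, Finset.sum_add_distrib, ← Finset.mul_sum,
      sum_eq_one_of_mem_orderComplex (f z.2).2, sum_eq_one_of_mem_orderComplex z.2.2]
    ring
  have hsupp : ∀ z, support (W z) ⊆ support (z.2 : α → ℝ) := fun z p hp hz => hp <| by
    have : (f z.2 : α → ℝ) p = 0 := by
      by_contra h
      exact hf z.2 h hz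
    simp [W, this, hz]
  have hc : Continuous W := by
    refine continuous_pi fun p => ?_
    have h1 : Continuous fun z : unitInterval × orderComplex P => (f z.2 : α → ℝ) p :=
      (continuous_apply p).comp (continuous_subtype_val.comp (f.continuous.comp continuous_snd))
    have h2 : Continuous fun z : unitInterval × orderComplex P => (z.2 : α → ℝ) p :=
      (continuous_apply p).comp (continuous_subtype_val.comp continuous_snd)
    have h3 : Continuous fun z : unitInterval × orderComplex P => (z.1 : ℝ) :=
      continuous_subtype_val.comp continuous_fst
    exact ((continuous_const.sub h3).mul h1).add (h3.mul h2)
  have hW : ∀ z, IsWeight P (W z) := fun z =>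
    { nonneg := fun p => add_nonneg
        (mul_nonneg (sub_nonneg.2 z.1.2.2) ((f z.2).2.1 p)) (mul_nonneg z.1.2.1 (z.2.2.1 p))
      support_subset := (hsupp z).trans z.2.2.2.2.1
      chain := z.2.2.2.2.2.1.mono (hsupp z)
      exists_ne := by
        by_contra! h
        simpa [h] using hsum z }
  refine ⟨⟨normalizedMap W hc hW, fun x => ?_, fun x => ?_⟩⟩ <;>
  · refine Subtype.ext (funext fun p => ?_)
    simp only [normalizedMap, hsum]
    simp [W]

lemma exists_prismWeight_ne_zero {Q : Set α} (a b : Finset α → α) (s : ℝ) {x : α → ℝ}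
    (hx : x ∈ orderComplex Q) : ∃ p, prismWeight a b s x p ≠ 0 := by
  classical
  obtain ⟨q, hq⟩ := (isWeight_of_mem_orderComplex hx).exists_ne
  obtain ⟨m, -, hm⟩ := Finset.exists_max_image Finset.univ x ⟨q, Finset.mem_univ q⟩
  have hpos : 0 < x m :=
    (lt_of_le_of_ne (hx.1 q) hq.symm).trans_le (hm q (Finset.mem_univ q))
  let S : Finset α := {p | x p = x m}
  have hS : ∀ {p}, p ∈ S ↔ x p = x m := by simp [S]
  have hlt : ∀ p ∉ S, x p < x m := fun p hp =>
    lt_of_le_of_ne (hm p (Finset.mem_univ p)) (mt hS.2 hp)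
  have hne : S.Nonempty := ⟨m, hS.2 rfl⟩
  have hgap : ∀ p ∈ S, ∀ p' ∉ S, x p' < x p := fun p hp p' hp' => hS.1 hp ▸ hlt p' hp'
  rcases lt_or_ge s (x m) with hs | hs
  · exact ⟨b S, prismWeight_ne_zero_iff.2 ⟨S, hne, Or.inr ⟨rfl,
      upperWeight_ne_zero_iff.2 ⟨hgap, fun p hp => by rwa [hS.1 hp]⟩⟩⟩⟩
  · exact ⟨a S, prismWeight_ne_zero_iff.2 ⟨S, hne, Or.inl ⟨rfl,
      lowerWeight_ne_zero_iff.2 ⟨hgap, fun p hp => (hlt p hp).trans_le hs,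
        fun p hp => by rwa [hS.1 hp], hpos.trans_le hs⟩⟩⟩⟩

lemma isWeight_prismWeight {P Q : Set α} {a b : Finset α → α} (ha : Antitone a) (hb : Antitone b)
    (hab : ∀ S, a S ≤ b S)
    (hmem : ∀ S : Finset α, S.Nonempty → (S : Set α) ⊆ Q → IsChain (· ≤ ·) (S : Set α) →
      a S ∈ P ∧ b S ∈ P)
    {s : ℝ} (hs : 0 ≤ s) {x : α → ℝ} (hx : x ∈ orderComplex Q) :
    IsWeight P (prismWeight a b s x) where
  nonneg p := Finset.sum_nonneg fun S _ => add_nonneg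
    (by split_ifs <;> simp [lowerWeight_nonneg]) (by split_ifs <;> simp [upperWeight_nonneg])
  support_subset p hp := by
    obtain ⟨S, hne, hS, h⟩ := exists_subset_support_of_prismWeight_ne_zero hs hp
    have := hmem S hne (hS.trans hx.2.2.1) (hx.2.2.2.1.mono hS)
    rcases h with rfl | rfl
    exacts [this.1, this.2]
  chain := by
    have hmixed : ∀ {S T}, lowerWeight s x S ≠ 0 → upperWeight s x T ≠ 0 → a S ≤ b T := by
      intro S T hS hT
      rw [lowerWeight_ne_zero_iff] at hS
      rw [upperWeight_ne_zero_iff] at hT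
      have hTS : T ⊆ S := fun q hq => by
        by_contra hqS
        exact (hS.2.1 q hqS).asymm (hT.2 q hq)
      exact (ha hTS).trans (hab T)
    intro p hp q hq _
    obtain ⟨S, -, ⟨rfl, hS⟩ | ⟨rfl, hS⟩⟩ := prismWeight_ne_zero_iff.1 hp <;>
    obtain ⟨T, -, ⟨rfl, hT⟩ | ⟨rfl, hT⟩⟩ := prismWeight_ne_zero_iff.1 hq
    · exact (subset_or_subset_of_gap (lowerWeight_ne_zero_iff.1 hS).1
        (lowerWeight_ne_zero_iff.1 hT).1).symm.imp (fun h => ha h) fun h => ha h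
    · exact Or.inl (hmixed hS hT)
    · exact Or.inr (hmixed hT hS)
    · exact (subset_or_subset_of_gap (upperWeight_ne_zero_iff.1 hS).1
        (upperWeight_ne_zero_iff.1 hT).1).symm.imp (fun h => hb h) fun h => hb h
  exists_ne := exists_prismWeight_ne_zero a b s hx

/-- The inclusion of order complexes induced by an inclusion of posets. -/
def orderComplexInclusion {P Q : Set α} (h : P ⊆ Q) : C(orderComplex P, orderComplex Q) where
  toFun x := ⟨x, x.2.1, x.2.2.1, x.2.2.2.1.trans h, x.2.2.2.2⟩
  continuous_toFun := continuous_subtype_val.subtype_mk _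

/-- Let `P ⊆ Q`, let `b` be an antitone map from chains of `Q` to `P` which dominates the
antitone map `a` choosing an element of each chain, and which agrees with `a` on chains of `P`.
Then the order complexes of `P` and `Q` are homotopy equivalent. -/
theorem nonempty_homotopyEquiv_orderComplex {P Q : Set α} (hPQ : P ⊆ Q) {a b : Finset α → α}
    (ha : Antitone a) (hb : Antitone b) (hab : ∀ S, a S ≤ b S)
    (ha_mem : ∀ S : Finset α, S.Nonempty → IsChain (· ≤ ·) (S : Set α) → a S ∈ S)
    (hb_mem : ∀ S : Finset α, S.Nonempty → (S : Set α) ⊆ Q → IsChain (· ≤ ·) (S : Set α) →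
      b S ∈ P)
    (hb_eq : ∀ S : Finset α, S.Nonempty → (S : Set α) ⊆ P → IsChain (· ≤ ·) (S : Set α) →
      b S = a S) :
    Nonempty (ContinuousMap.HomotopyEquiv (orderComplex P) (orderComplex Q)) := by
  have hcρ : Continuous fun x : orderComplex Q => prismWeight b b 0 (x : α → ℝ) :=
    continuous_prismWeight b b continuous_const continuous_subtype_val
  have hcH : Continuous fun z : unitInterval × orderComplex Q =>
      prismWeight a b (z.1 : ℝ) (z.2 : α → ℝ) :=
    continuous_prismWeight a b (continuous_subtype_val.comp continuous_fst)
      (continuous_subtype_val.comp continuous_snd)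
  have hWρ : ∀ x : orderComplex Q, IsWeight P (prismWeight b b 0 (x : α → ℝ)) := fun x =>
    isWeight_prismWeight hb hb (fun _ => le_rfl)
      (fun S h1 h2 h3 => ⟨hb_mem S h1 h2 h3, hb_mem S h1 h2 h3⟩) le_rfl x.2
  have hWH : ∀ z : unitInterval × orderComplex Q,
      IsWeight Q (prismWeight a b (z.1 : ℝ) (z.2 : α → ℝ)) := fun z =>
    isWeight_prismWeight ha hb hab
      (fun S h1 h2 h3 => ⟨h2 (ha_mem S h1 h3), hPQ (hb_mem S h1 h2 h3)⟩) z.1.2.1 z.2.2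
  let ρ : C(orderComplex Q, orderComplex P) := normalizedMap _ hcρ hWρ
  let H : C(unitInterval × orderComplex Q, orderComplex Q) := normalizedMap _ hcH hWH
  let μ : C(orderComplex Q, orderComplex Q) := H.comp ((ContinuousMap.const _ 1).prodMk (.id _))
  have hH : ((orderComplexInclusion hPQ).comp ρ).Homotopic μ := by
    refine ⟨⟨H, fun x => ?_, fun x => rfl⟩⟩
    refine Subtype.ext (funext fun p => ?_)
    simp [H, ρ, normalizedMap, orderComplexInclusion, prismWeight_zero a b b]
  have hμ : μ.Homotopic (.id _) := by
    refine homotopic_id_of_support_subset μ fun x p hp => ?_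
    have hp' : prismWeight a b 1 x p ≠ 0 :=
      (support_normalizedMap _ hcH hWH (1, x)).subset hp
    obtain ⟨S, hne, hS | ⟨-, hw⟩⟩ := prismWeight_ne_zero_iff.1 hp'
    · obtain ⟨rfl, hw⟩ := hS
      have hS : (S : Set α) ⊆ support (x : α → ℝ) := fun q hq =>
        ((lowerWeight_ne_zero_iff.1 hw).2.2.1 q hq).ne'
      exact hS (ha_mem S hne (x.2.2.2.2.1.mono hS))
    · obtain ⟨q, hq⟩ := hne
      have h1 := (upperWeight_ne_zero_iff.1 hw).2 q hq
      have h2 := Finset.single_le_sum (f := (x : α → ℝ)) (fun i _ => x.2.1 i) (Finset.mem_univ q)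
      rw [sum_eq_one_of_mem_orderComplex x.2] at h2
      exact absurd h1 h2.not_gt
  refine ⟨⟨orderComplexInclusion hPQ, ρ, ?_, hH.trans hμ⟩⟩
  refine homotopic_id_of_support_subset _ fun x p hp => ?_
  have hp' : prismWeight b b 0 x p ≠ 0 :=
    (support_normalizedMap _ hcρ hWρ (orderComplexInclusion hPQ x)).subset hp
  obtain ⟨S, hne, hS, h⟩ := exists_subset_support_of_prismWeight_ne_zero le_rfl hp'
  have hchain := x.2.2.2.2.1.mono hS
  rw [or_self, hb_eq S hne (hS.trans x.2.2.2.1) hchain] at h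
  exact hS (h ▸ ha_mem S hne hchain)

end Realization

section Matroid

variable {n : ℕ} (M : Matroid (Fin n))

lemma mrk_univ_le_ncard_of_closure_eq_univ {σ : Set (Fin n)} (hσ : M.closure σ = Set.univ) :
    mrk M Set.univ ≤ σ.ncard := by
  refine csSup_le ⟨0, ∅, M.empty_indep, Set.empty_subset _, Set.ncard_empty _⟩ ?_
  rintro k ⟨I, hI, -, rfl⟩
  have h : I.encard ≤ σ.encard := by
    rw [← hI.eRk_eq_encard]
    calc M.eRk I ≤ M.eRk (M.closure σ) := M.eRk_mono (hσ ▸ Set.subset_univ I)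
      _ = M.eRk σ := M.eRk_closure_eq σ
      _ ≤ σ.encard := M.eRk_le_encard σ
  rw [← σ.toFinite.cast_ncard_eq, ← I.toFinite.cast_ncard_eq] at h
  exact_mod_cast h

lemma card_le_of_isChain_properSpanning {C : Finset (Set (Fin n))}
    (hC : (C : Set (Set (Fin n))) ⊆ properSpanning M)
    (hchain : IsChain (· ⊆ ·) (C : Set (Set (Fin n)))) : C.card ≤ n - mrk M Set.univ := by
  rw [← Nat.card_Ico]
  refine Finset.card_le_card_of_injOn Set.ncard (fun σ hσ => ?_) fun σ hσ τ hτ h => ?_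
  · have hlt := Set.ncard_lt_ncard (Set.ssubset_univ_iff.2 (hC hσ).2)
    rw [Set.ncard_univ, Nat.card_fin] at hlt
    exact Finset.mem_coe.2
      (Finset.mem_Ico.2 ⟨mrk_univ_le_ncard_of_closure_eq_univ M (hC hσ).1, hlt⟩)
  · rcases hchain.total hσ hτ with hs | hs
    · exact Set.eq_of_subset_of_ncard_le hs h.ge
    · exact (Set.eq_of_subset_of_ncard_le hs h.le).symm

/-- The complement of the set of all elements added by closing some member of `S`. -/
def closureGapCompl (S : Finset (Set (Fin n))) : Set (Fin n) :=
  (⋃ q ∈ S, M.closure q \ q)ᶜ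

variable {M}

lemma mem_closureGapCompl {S : Finset (Set (Fin n))} {x : Fin n} :
    x ∈ closureGapCompl M S ↔ ∀ q ∈ S, x ∈ M.closure q → x ∈ q := by
  simp [closureGapCompl]

lemma subset_closure_closureGapCompl (hE : M.E = Set.univ) {S : Finset (Set (Fin n))}
    (hS : IsChain (· ≤ ·) (S : Set (Set (Fin n)))) :
    ∀ q ∈ S, q ⊆ M.closure (closureGapCompl M S) := by
  intro q
  induction q using WellFoundedLT.induction with
  | ind q ih =>
    intro hq x hx
    by_cases hxG : x ∈ closureGapCompl M S
    · exact M.mem_closure_of_mem' hxG (hE ▸ Set.mem_univ x)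
    · rw [mem_closureGapCompl] at hxG
      push Not at hxG
      obtain ⟨p, hp, hxp, hxp'⟩ := hxG
      have hpq : p < q := by
        rcases hS.total hp hq with h | h
        · exact lt_of_le_of_ne h fun h => hxp' (h ▸ hx)
        · exact absurd (h hx) hxp'
      exact M.closure_subset_closure_of_subset_closure (ih p hpq hp) hxp

lemma closure_closureGapCompl (hE : M.E = Set.univ) {S : Finset (Set (Fin n))}
    (hS : IsChain (· ≤ ·) (S : Set (Set (Fin n)))) :
    M.closure (closureGapCompl M S) = Set.univ := by
  refine Set.eq_univ_of_forall fun x => ?_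
  by_cases hxG : x ∈ closureGapCompl M S
  · exact M.mem_closure_of_mem' hxG (hE ▸ Set.mem_univ x)
  · rw [mem_closureGapCompl] at hxG
    push Not at hxG
    obtain ⟨p, hp, hxp, -⟩ := hxG
    exact M.closure_subset_closure_of_subset_closure
      (subset_closure_closureGapCompl hE hS p hp) hxp

lemma properSpanning_subset_properNonFlats (hLoopless : M.closure ∅ = ∅) :
    properSpanning M ⊆ properNonFlats M := by
  rintro σ ⟨hσ, hne⟩
  refine ⟨Set.nonempty_iff_ne_empty.2 ?_, hne, fun h => hne (h.symm.trans hσ)⟩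
  rintro rfl
  exact hne (hLoopless.symm.trans hσ)

lemma sInf_mem_of_isChain {S : Finset (Set (Fin n))} (hne : S.Nonempty)
    (hS : IsChain (· ≤ ·) (S : Set (Set (Fin n)))) : sInf (S : Set (Set (Fin n))) ∈ S := by
  obtain ⟨m, hm⟩ := S.exists_minimal hne
  have hleast : IsLeast (S : Set (Set (Fin n))) m := ⟨hm.1, fun q hq =>
    (hS.total hm.1 hq).elim id fun h => hm.2 hq h⟩
  rw [hleast.csInf_eq]
  exact hm.1

lemma closureGapCompl_mem_properSpanning (hE : M.E = Set.univ) {S : Finset (Set (Fin n))}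
    (hne : S.Nonempty) (hSQ : (S : Set (Set (Fin n))) ⊆ properNonFlats M)
    (hS : IsChain (· ≤ ·) (S : Set (Set (Fin n)))) : closureGapCompl M S ∈ properSpanning M := by
  refine ⟨closure_closureGapCompl hE hS, fun h => ?_⟩
  obtain ⟨q, hq⟩ := hne
  refine (hSQ hq).2.2 (Set.Subset.antisymm (fun x hx => ?_)
    (M.subset_closure q (hE ▸ Set.subset_univ q)))
  exact mem_closureGapCompl.1 (h ▸ Set.mem_univ x) q hq hx

lemma closureGapCompl_eq_sInf {S : Finset (Set (Fin n))}
    (hSP : (S : Set (Set (Fin n))) ⊆ properSpanning M) :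
    closureGapCompl M S = sInf (S : Set (Set (Fin n))) := by
  ext x
  rw [mem_closureGapCompl, Set.sInf_eq_sInter, Set.mem_sInter]
  exact forall₂_congr fun q hq => by simp [(hSP hq).1]

end Matroid

/-- **An efficient model for the complement of a geometric lattice.**  For a loopless
matroid of rank `r` on `{1,…,n}`: (i) every chain of proper spanning subsets has at
most `n - r` elements (so the order complex of proper spanning subsets has dimension
at most `n - r - 1`), and (ii) this order complex is homotopy equivalent to the order
complex of the poset of proper nonempty non-flats of `M`. -/
theorem spanning_model_for_complement
    {n r : ℕ} (M : Matroid (Fin n)) (hE : M.E = Set.univ)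
    (hLoopless : M.closure ∅ = ∅)
    (hrank : mrk M Set.univ = r) :
    (∀ C : Finset (Set (Fin n)), (↑C : Set (Set (Fin n))) ⊆ properSpanning M →
        IsChain (· ⊆ ·) (↑C : Set (Set (Fin n))) → C.card ≤ n - r) ∧
    Nonempty (ContinuousMap.HomotopyEquiv
      (↥(orderComplex (properSpanning M)))
      (↥(orderComplex (properNonFlats M)))) := by
  subst hrank
  refine ⟨fun C hC hchain => card_le_of_isChain_properSpanning M hC hchain, ?_⟩
  refine nonempty_homotopyEquiv_orderComplex (a := fun S => sInf (S : Set (Set (Fin n))))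
    (b := closureGapCompl M) (properSpanning_subset_properNonFlats hLoopless)
    (fun S T h => sInf_le_sInf (Finset.coe_subset.2 h)) (fun S T h x hx => ?_)
    (fun S x hx => ?_) (fun S hne hS => sInf_mem_of_isChain hne hS)
    (fun S => closureGapCompl_mem_properSpanning hE)
    (fun S _ hSP _ => closureGapCompl_eq_sInf hSP)
  · exact mem_closureGapCompl.2 fun q hq => mem_closureGapCompl.1 hx q (h hq)
  · exact mem_closureGapCompl.2 fun q hq _ => Set.mem_sInter.1 hx q hq
end
end

section
/- Let 2 ≤ r ≤ m and let U be the uniform matroid of rank r on E = {1,…,m}, whose proper nonempty flats are exactly the nonempty subsets of E of cardinality at most r−1. Fix vectors e_1,…,e_m ∈ ℝ^{m−1} with e_1 + ⋯ + e_m = 0 and every proper subset of {e_1,…,e_m} linearly independent, and let B(U) be the Bergman fan of U. Then for every integer 0 ≤ p ≤ r−1, the p-group F_p(B(U)) equals the full exterior power Λ^p(ℝ^{m−1}). -/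
open Function

noncomputable section

/-- The set of all nonnegative linear combinations of elements of `s`
(the positive span, a convex cone; `posSpan ∅ = {0}`). -/
def posSpan {V : Type*} [AddCommMonoid V] [Module ℝ V] (s : Set V) : Set V :=
  {x | ∃ (T : Finset V) (c : V → ℝ), (↑T : Set V) ⊆ s ∧ (∀ v, 0 ≤ c v) ∧
        x = ∑ v ∈ T, c v • v}

/-- The `p`-group of a family `cones` of cones in `V`: the span, in the exterior
algebra, of the wedge products `v_1 ∧ ⋯ ∧ v_p` of vectors lying in the linear span of
a common member of `cones`. -/
def pGroup {V : Type*} [AddCommGroup V] [Module ℝ V] (p : ℕ) (cones : Set (Set V)) :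
    Submodule ℝ (ExteriorAlgebra ℝ V) :=
  Submodule.span ℝ
    {w | ∃ (v : Fin p → V) (c : Set V), c ∈ cones ∧
      (∀ i, v i ∈ Submodule.span ℝ c) ∧
      w = (List.ofFn fun i => ExteriorAlgebra.ι ℝ (v i)).prod}

/-- The linear span of the cone `posSpan s` contains `s`. -/
theorem mem_span_posSpan {V : Type*} [AddCommGroup V] [Module ℝ V] {s : Set V} {x : V}
    (hx : x ∈ s) : x ∈ Submodule.span ℝ (posSpan s) :=
  Submodule.subset_span ⟨{x}, fun _ => 1, by simpa using hx, fun _ => zero_le_one, by simp⟩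

/-- If `f` is injective, the vector `e_{f i}` is a difference of two consecutive vectors `e_F`
along the flag of initial segments of `f`. -/
theorem apply_mem_span_posSpan_flag {V : Type*} [AddCommGroup V] [Module ℝ V] {n p : ℕ}
    (e : Fin n → V) {f : Fin p → Fin n} (hf : Function.Injective f) (i : Fin p) :
    e (f i) ∈ Submodule.span ℝ
      (posSpan (eVec e '' Set.range fun j : Fin p => f '' Set.Iic j)) := by
  have hmem (j : Fin p) : eVec e (f '' Set.Iic j) ∈ Submodule.span ℝ
      (posSpan (eVec e '' Set.range fun j : Fin p => f '' Set.Iic j)) :=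
    mem_span_posSpan ⟨_, ⟨j, rfl⟩, rfl⟩
  have hinsert : eVec e (f '' Set.Iic i) = e (f i) + eVec e (f '' Set.Iio i) := by
    rw [← Set.Iio_insert, Set.image_insert_eq, eVec, eVec,
      finsum_mem_insert _ (by simp [hf.eq_iff]) (Set.toFinite _)]
  rw [eq_sub_of_add_eq hinsert.symm]
  refine Submodule.sub_mem _ (hmem i) ?_
  rcases i with ⟨_ | k, hk⟩
  · have : Set.Iio (⟨0, hk⟩ : Fin p) = ∅ := by
      ext j; simp [Fin.lt_def]
    simp [this, eVec]
  · have : Set.Iio (⟨k + 1, hk⟩ : Fin p) = Set.Iic ⟨k, by omega⟩ := by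
      ext j; simp [Fin.lt_def, Fin.le_def]
    rw [this]
    exact hmem _

/-- **The `p`-groups of the Bergman fan of a uniform matroid are full.** Let `U` be
the uniform matroid of rank `r` on `{1,…,m}` (`2 ≤ r ≤ m`), whose proper nonempty
flats are the nonempty subsets of cardinality at most `r - 1`.  Then for every
`p ≤ r - 1`, the `p`-group of the Bergman fan `B(U)` is all of `Λ^p(ℝ^{m-1})`. -/
theorem uniform_bergmanFan_pGroup_full
    {m r : ℕ} (hr : 2 ≤ r) (hrm : r ≤ m)
    (e : Fin m → EuclideanSpace ℝ (Fin (m - 1)))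
    (hsum : ∑ i, e i = 0)
    (hind : ∀ s : Finset (Fin m), s ≠ Finset.univ →
      LinearIndependent ℝ (fun i : ↥s => e ↑i))
    (p : ℕ) (hp : p ≤ r - 1) :
    pGroup p
        {K | ∃ C : Set (Set (Fin m)),
          C ⊆ {S | S.Nonempty ∧ S.ncard ≤ r - 1} ∧ IsChain (· ⊆ ·) C ∧
          K = posSpan (eVec e '' C)} =
      ⋀[ℝ]^p (EuclideanSpace ℝ (Fin (m - 1))) := by
  have htop : Submodule.span ℝ (Set.range e) = ⊤ := by
    have hcard : 0 < m := by omega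
    let s : Finset (Fin m) := Finset.univ.erase ⟨0, hcard⟩
    have hs : s ≠ Finset.univ := by simp [s]
    have hspan := (hind s hs).span_eq_top_of_card_eq_finrank' (by simp [s])
    rw [eq_top_iff, ← hspan]
    exact Submodule.span_mono (by rintro _ ⟨i, rfl⟩; exact ⟨i, rfl⟩)
  apply le_antisymm
  · refine Submodule.span_le.mpr ?_
    rintro _ ⟨v, c, -, -, rfl⟩
    rw [← ExteriorAlgebra.ιMulti_apply]
    exact ExteriorAlgebra.ιMulti_range ℝ p ⟨_, rfl⟩
  · rw [← exteriorPower.ιMulti_span_fixedDegree_of_span_eq_top ℝ p _ htop, Submodule.span_le]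
    rintro _ ⟨v, hv, rfl⟩
    choose f hef using fun i => hv ⟨i, rfl⟩
    obtain rfl : e ∘ f = v := funext hef
    by_cases hf : Function.Injective f
    · refine Submodule.subset_span ⟨e ∘ f, _,
        ⟨Set.range fun j : Fin p => f '' Set.Iic j, ?_, ?_, rfl⟩,
        apply_mem_span_posSpan_flag e hf, ExteriorAlgebra.ιMulti_apply _⟩
      · rintro _ ⟨j, rfl⟩
        refine ⟨⟨f j, j, Set.self_mem_Iic, rfl⟩, ?_⟩
        calc (f '' Set.Iic j).ncard ≤ (Set.Iic j).ncard := Set.ncard_image_le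
          _ ≤ p := by simpa using Set.ncard_le_card (Set.Iic j)
          _ ≤ r - 1 := hp
      · have hmono : Monotone fun j : Fin p => f '' Set.Iic j :=
          fun _ _ h => Set.image_mono (Set.Iic_subset_Iic.mpr h)
        exact hmono.isChain_range
    · have hnot : ¬ Function.Injective (e ∘ f) := fun h => hf h.of_comp
      simp [AlternatingMap.map_eq_zero_of_not_injective _ _ hnot]
end
end

section
/- Let M be a loopless matroid of rank r ≥ 2 on E = {1,…,n}, let B(M) ⊆ ℝ^{n−1} be its Bergman fan, and let ν ∈ ℝ^{n−1} satisfy ⟨ν, e_σ⟩ ≠ 0 for every σ with ∅ ⊊ σ ⊊ E. Let H^+ = {x ∈ ℝ^{n−1} : ⟨ν, x⟩ ≥ 0}. For p ≥ 0 let F_p(B(M) ∩ H^+) be the linear subspace of Λ^p(ℝ^{n−1}) spanned by all wedge products v_1 ∧ ⋯ ∧ v_p for which there is a single chain C of proper nonempty flats of M with v_1,…,v_p all in the ℝ-linear span of the set pos(C) ∩ H^+. Then for every integer 0 ≤ p ≤ r−2, F_p(B(M) ∩ H^+) = F_p(B(M)); that is, every element of the p-group of the Bergman fan is a linear combination of elements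 of the p-group of its intersection with the halfspace. -/
open Function
open scoped RealInnerProductSpace

noncomputable section

section SubsetVectors

variable {n : ℕ} {V : Type*} [AddCommGroup V]

open Classical in
lemma eVec_eq_sum (e : Fin n → V) (S : Set (Fin n)) :
    eVec e S = ∑ i, if i ∈ S then e i else 0 := by
  rw [eVec, finsum_mem_def, finsum_eq_sum_of_fintype]
  simp [Set.indicator_apply]

@[simp]
lemma eVec_empty (e : Fin n → V) : eVec e ∅ = 0 := by
  simp [eVec_eq_sum]

lemma eVec_univ (e : Fin n → V) : eVec e Set.univ = ∑ i, e i := by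
  simp [eVec_eq_sum]

end SubsetVectors

section Flats

variable {n : ℕ} (M : Matroid (Fin n))

open Classical in
/-- The flats `G` with `A ⊆ G ⊆ B` whose rank exceeds the rank of `A` by one. -/
def flatCovers (A B : Set (Fin n)) : Finset (Set (Fin n)) :=
  Finset.univ.filter fun G => M.IsFlat G ∧ M.eRk G = M.eRk A + 1 ∧ A ⊆ G ∧ G ⊆ B

variable {M}

lemma mem_flatCovers {A B G : Set (Fin n)} :
    G ∈ flatCovers M A B ↔ M.IsFlat G ∧ M.eRk G = M.eRk A + 1 ∧ A ⊆ G ∧ G ⊆ B := by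
  classical
  simp [flatCovers]

lemma eRk_ne_top_of_fin (X : Set (Fin n)) : M.eRk X ≠ ⊤ :=
  ((M.eRk_le_encard X).trans_lt (Set.toFinite X).encard_lt_top).ne

lemma isFlat_univ (hE : M.E = Set.univ) : M.IsFlat Set.univ := hE ▸ M.ground_isFlat

lemma eRk_closure_insert (hE : M.E = Set.univ) {A : Set (Fin n)} (hA : M.IsFlat A) {x : Fin n}
    (hx : x ∉ A) : M.eRk (M.closure (insert x A)) = M.eRk A + 1 := by
  rw [M.eRk_closure_eq, M.eRk_insert_eq_add_one ⟨hE ▸ Set.mem_univ x, by rwa [hA.closure]⟩]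

lemma subset_closure_insert (hE : M.E = Set.univ) (A : Set (Fin n)) (x : Fin n) :
    insert x A ⊆ M.closure (insert x A) :=
  M.subset_closure _ (hE ▸ Set.subset_univ _)

lemma eq_closure_insert_of_mem_flatCovers (hE : M.E = Set.univ) {A B G : Set (Fin n)}
    (hA : M.IsFlat A) (hG : G ∈ flatCovers M A B) {x : Fin n} (hxG : x ∈ G) (hxA : x ∉ A) :
    G = M.closure (insert x A) := by
  obtain ⟨hGf, hr, hAG, -⟩ := mem_flatCovers.1 hG
  have hsub : insert x A ⊆ G := Set.insert_subset hxG hAG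
  have hfin : M.IsRkFinite (insert x A) :=
    Matroid.eRk_ne_top_iff.1 (eRk_ne_top_of_fin _)
  have h := hfin.closure_eq_closure_of_subset_of_eRk_ge_eRk hsub
    (by rw [hr, ← M.eRk_closure_eq (insert x A), eRk_closure_insert hE hA hxA])
  rw [h, hGf.closure]

lemma closure_insert_mem_flatCovers (hE : M.E = Set.univ) {A B : Set (Fin n)}
    (hA : M.IsFlat A) (hB : M.IsFlat B) (hAB : A ⊆ B) {x : Fin n} (hxB : x ∈ B) (hxA : x ∉ A) :
    M.closure (insert x A) ∈ flatCovers M A B := by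
  refine mem_flatCovers.2 ⟨M.isFlat_closure _, eRk_closure_insert hE hA hxA,
    (Set.subset_insert _ _).trans (subset_closure_insert hE A x), ?_⟩
  calc M.closure (insert x A) ⊆ M.closure B :=
        M.closure_subset_closure (Set.insert_subset hxB hAB)
    _ = B := hB.closure

/-- The covers of a flat `A` inside a flat `B` partition `B \ A`. -/
lemma sum_flatCovers_sub {V : Type*} [AddCommGroup V] [Module ℝ V] (hE : M.E = Set.univ)
    (e : Fin n → V) {A B : Set (Fin n)} (hA : M.IsFlat A) (hB : M.IsFlat B) (hAB : A ⊆ B) :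
    ∑ G ∈ flatCovers M A B, (eVec e G - eVec e A) = eVec e B - eVec e A := by
  classical
  have hdiff : ∀ G, A ⊆ G →
      eVec e G - eVec e A = ∑ i, if i ∈ G ∧ i ∉ A then e i else 0 := by
    intro G hG
    rw [eVec_eq_sum, eVec_eq_sum, ← Finset.sum_sub_distrib]
    refine Finset.sum_congr rfl fun i _ => ?_
    by_cases h1 : i ∈ A
    · simp [h1, hG h1]
    · simp [h1]
  rw [hdiff B hAB, Finset.sum_congr rfl fun G hG => hdiff G (mem_flatCovers.1 hG).2.2.1,
    Finset.sum_comm]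
  refine Finset.sum_congr rfl fun i _ => ?_
  by_cases hi : i ∈ B ∧ i ∉ A
  · rw [if_pos hi, Finset.sum_eq_single (M.closure (insert i A))]
    · rw [if_pos ⟨subset_closure_insert hE A i (Set.mem_insert _ _), hi.2⟩]
    · intro G hG hne
      rw [if_neg]
      rintro ⟨hiG, hiA⟩
      exact hne (eq_closure_insert_of_mem_flatCovers hE hA hG hiG hiA)
    · intro h
      exact absurd (closure_insert_mem_flatCovers hE hA hB hAB hi.1 hi.2) h
  · rw [if_neg hi]
    refine Finset.sum_eq_zero fun G hG => if_neg ?_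
    rintro ⟨hiG, hiA⟩
    exact hi ⟨(mem_flatCovers.1 hG).2.2.2 hiG, hiA⟩

lemma sum_flatCovers {V : Type*} [AddCommGroup V] [Module ℝ V] (hE : M.E = Set.univ)
    (e : Fin n → V) {A B : Set (Fin n)} (hA : M.IsFlat A) (hB : M.IsFlat B) (hAB : A ⊆ B) :
    ∑ G ∈ flatCovers M A B, eVec e G =
      eVec e B + (((flatCovers M A B).card : ℝ) - 1) • eVec e A := by
  have h := sum_flatCovers_sub hE e hA hB hAB
  rw [Finset.sum_sub_distrib, Finset.sum_const, sub_eq_iff_eq_add] at h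
  rw [h, sub_smul, one_smul, Nat.cast_smul_eq_nsmul]
  abel

end Flats

section Flags

variable {n p : ℕ} (M : Matroid (Fin n))

/-- A multichain of flats whose first `k` members have ranks `1, …, k`. -/
structure IsFlatFlag (k : ℕ) (f : Fin p → Set (Fin n)) : Prop where
  isFlat : ∀ i, M.IsFlat (f i)
  mono : Monotone f
  eRk_eq : ∀ i : Fin p, (i : ℕ) < k → M.eRk (f i) = (i : ℕ) + 1

/-- The union of the members of `f` of index below `i`. -/
def lowerFlat (f : Fin p → Set (Fin n)) (i : Fin p) : Set (Fin n) := ⋃ j < i, f j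

/-- The intersection of the members of `f` of index above `i`. -/
def upperFlat (f : Fin p → Set (Fin n)) (i : Fin p) : Set (Fin n) := ⋂ j > i, f j

variable {M}

lemma lowerFlat_of_eq_zero (f : Fin p → Set (Fin n)) {i : Fin p} (hi : (i : ℕ) = 0) :
    lowerFlat f i = ∅ := by
  simp only [lowerFlat, Set.iUnion_eq_empty]
  intro j hj
  have : (j : ℕ) < i := hj
  omega

lemma lowerFlat_of_succ {f : Fin p → Set (Fin n)} (hf : Monotone f) {i j : Fin p}
    (hj : (j : ℕ) + 1 = i) : lowerFlat f i = f j := by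
  refine Set.Subset.antisymm (Set.iUnion₂_subset fun k hk => hf ?_) ?_
  · have : (k : ℕ) < i := hk
    exact Fin.le_def.2 (by omega)
  · exact Set.subset_iUnion₂_of_subset j (Fin.lt_def.2 (by omega)) subset_rfl

lemma upperFlat_of_last (f : Fin p → Set (Fin n)) {i : Fin p} (hi : (i : ℕ) + 1 = p) :
    upperFlat f i = Set.univ := by
  simp only [upperFlat, Set.iInter_eq_univ]
  intro j hj
  have : (i : ℕ) < j := hj
  omega

lemma upperFlat_of_succ {f : Fin p → Set (Fin n)} (hf : Monotone f) {i j : Fin p}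
    (hj : (i : ℕ) + 1 = j) : upperFlat f i = f j := by
  refine Set.Subset.antisymm ?_ (Set.subset_iInter₂ fun k hk => hf ?_)
  · exact Set.iInter₂_subset_of_subset j (Fin.lt_def.2 (by omega)) subset_rfl
  · have : (i : ℕ) < k := hk
    exact Fin.le_def.2 (by omega)

lemma lowerFlat_subset {f : Fin p → Set (Fin n)} (hf : Monotone f) (i : Fin p) :
    lowerFlat f i ⊆ f i :=
  Set.iUnion₂_subset fun _ hk => hf hk.le

lemma subset_upperFlat {f : Fin p → Set (Fin n)} (hf : Monotone f) (i : Fin p) :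
    f i ⊆ upperFlat f i :=
  Set.subset_iInter₂ fun _ hk => hf (le_of_lt hk)

lemma monotone_update {f : Fin p → Set (Fin n)} (hf : Monotone f) {i : Fin p}
    {G : Set (Fin n)} (h1 : lowerFlat f i ⊆ G) (h2 : G ⊆ upperFlat f i) :
    Monotone (update f i G) := by
  intro a b hab
  by_cases ha : a = i
  · subst ha
    by_cases hb : b = a
    · subst hb; exact le_rfl
    · rw [update_self, update_of_ne hb]
      exact h2.trans (Set.iInter₂_subset b (lt_of_le_of_ne hab (Ne.symm hb)))
  · rw [update_of_ne ha]
    by_cases hb : b = i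
    · subst hb
      rw [update_self]
      exact (Set.subset_iUnion₂ (s := fun j (_ : j < b) => f j) a
        (lt_of_le_of_ne hab ha)).trans h1
    · rw [update_of_ne hb]
      exact hf hab

namespace IsFlatFlag

variable {k : ℕ} {f : Fin p → Set (Fin n)}

lemma isFlat_lowerFlat (hf : IsFlatFlag M k f) (h0 : M.IsFlat ∅) (i : Fin p) :
    M.IsFlat (lowerFlat f i) := by
  by_cases hi : (i : ℕ) = 0
  · rwa [lowerFlat_of_eq_zero f hi]
  · rw [lowerFlat_of_succ hf.mono (j := ⟨i - 1, by omega⟩) (by simp; omega)]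
    exact hf.isFlat _

lemma eRk_lowerFlat (hf : IsFlatFlag M k f) {i : Fin p} (hi : (i : ℕ) ≤ k) :
    M.eRk (lowerFlat f i) = (i : ℕ) := by
  by_cases hi : (i : ℕ) = 0
  · simp [lowerFlat_of_eq_zero f hi, hi]
  · rw [lowerFlat_of_succ hf.mono (j := ⟨i - 1, by omega⟩) (by simp; omega),
      hf.eRk_eq _ (by simp; omega)]
    norm_cast
    simp; omega

lemma isFlat_upperFlat (hf : IsFlatFlag M k f) (hE : M.E = Set.univ) (i : Fin p) :
    M.IsFlat (upperFlat f i) := by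
  by_cases hi : (i : ℕ) + 1 = p
  · rw [upperFlat_of_last f hi]
    exact isFlat_univ hE
  · rw [upperFlat_of_succ hf.mono (j := ⟨i + 1, by omega⟩) rfl]
    exact hf.isFlat _

lemma update_of_mem_flatCovers (hf : IsFlatFlag M k f) {i : Fin p} (hi : (i : ℕ) ≤ k)
    {B G : Set (Fin n)} (hB : B ⊆ upperFlat f i) (hG : G ∈ flatCovers M (lowerFlat f i) B) :
    IsFlatFlag M (max k (i + 1)) (update f i G) := by
  obtain ⟨hG1, hG2, hG3, hG4⟩ := mem_flatCovers.1 hG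
  refine ⟨fun j => ?_, monotone_update hf.mono hG3 (hG4.trans hB), fun j hj => ?_⟩
  · by_cases h : j = i
    · subst h; rwa [update_self]
    · rw [update_of_ne h]; exact hf.isFlat j
  · by_cases h : j = i
    · subst h; rw [update_self, hG2, hf.eRk_lowerFlat hi]
    · rw [update_of_ne h]
      refine hf.eRk_eq j ?_
      have : (j : ℕ) ≠ i := fun h' => h (Fin.ext h')
      omega

variable {V : Type*} [AddCommGroup V] [Module ℝ V]

lemma map_update_lowerFlat (hf : IsFlatFlag M k f) (e : Fin n → V)
    (Ψ : V [⋀^Fin p]→ₗ[ℝ] ℝ) (i : Fin p) :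
    Ψ (update (eVec e ∘ f) i (eVec e (lowerFlat f i))) = 0 := by
  by_cases hi : (i : ℕ) = 0
  · rw [lowerFlat_of_eq_zero f hi, eVec_empty]
    exact Ψ.map_update_zero _ _
  · rw [lowerFlat_of_succ hf.mono (j := ⟨i - 1, by omega⟩) (by simp; omega)]
    exact Ψ.map_update_self (eVec e ∘ f) (i := i) (j := ⟨i - 1, by omega⟩)
      (fun h => by have := congrArg Fin.val h; simp at this; omega)

lemma map_update_upperFlat (hf : IsFlatFlag M k f) (e : Fin n → V) (hsum : ∑ i, e i = 0)
    (Ψ : V [⋀^Fin p]→ₗ[ℝ] ℝ) (i : Fin p) :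
    Ψ (update (eVec e ∘ f) i (eVec e (upperFlat f i))) = 0 := by
  by_cases hi : (i : ℕ) + 1 = p
  · rw [upperFlat_of_last f hi, eVec_univ, hsum]
    exact Ψ.map_update_zero _ _
  · rw [upperFlat_of_succ hf.mono (j := ⟨i + 1, by omega⟩) rfl]
    exact Ψ.map_update_self (eVec e ∘ f) (i := i) (j := ⟨i + 1, by omega⟩)
      (fun h => by have := congrArg Fin.val h; simp at this)

/-- Replacing one member of a flag by all covers of its predecessor inside a flat `B`. -/
lemma sum_map_update_flatCovers (hf : IsFlatFlag M k f) (hE : M.E = Set.univ)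
    (h0 : M.IsFlat ∅) (e : Fin n → V) (Ψ : V [⋀^Fin p]→ₗ[ℝ] ℝ) (i : Fin p)
    {B : Set (Fin n)} (hB : M.IsFlat B) (hAB : lowerFlat f i ⊆ B) :
    ∑ G ∈ flatCovers M (lowerFlat f i) B, Ψ (eVec e ∘ update f i G) =
      Ψ (update (eVec e ∘ f) i (eVec e B)) := by
  simp only [Function.comp_update]
  have h := Ψ.toMultilinearMap.map_update_sum (flatCovers M (lowerFlat f i) B) i (eVec e)
    (eVec e ∘ f)
  rw [sum_flatCovers hE e (hf.isFlat_lowerFlat h0 i) hB hAB] at h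
  simp only [AlternatingMap.coe_multilinearMap] at h
  rw [← h, Ψ.map_update_add, Ψ.map_update_smul, hf.map_update_lowerFlat, smul_zero, add_zero]

/-- An alternating form that vanishes on all flags of ranks `1, …, p` vanishes on all
multichains of flats. -/
lemma map_eq_zero_of_forall_flag (hE : M.E = Set.univ) (h0 : M.IsFlat ∅) (e : Fin n → V)
    (Ψ : V [⋀^Fin p]→ₗ[ℝ] ℝ)
    (hΨ : ∀ g : Fin p → Set (Fin n), IsFlatFlag M p g → Ψ (eVec e ∘ g) = 0)
    (hk : k ≤ p) (hf : IsFlatFlag M k f) : Ψ (eVec e ∘ f) = 0 := by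
  induction hk using Nat.decreasingInduction generalizing f with
  | self => exact hΨ f hf
  | of_succ k hk ih =>
    have h := hf.sum_map_update_flatCovers hE h0 e Ψ ⟨k, hk⟩ (hf.isFlat _)
      (lowerFlat_subset hf.mono _)
    have hself : update (eVec e ∘ f) ⟨k, hk⟩ (eVec e (f ⟨k, hk⟩)) = eVec e ∘ f :=
      update_eq_self _ _
    rw [hself] at h
    rw [← h]
    refine Finset.sum_eq_zero fun G hG => ih ?_
    have := hf.update_of_mem_flatCovers (i := ⟨k, hk⟩) le_rfl (subset_upperFlat hf.mono _) hG
    simpa using this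

end IsFlatFlag

end Flags

section WedgeWithFunctional

variable {n p : ℕ} {M : Matroid (Fin n)} {V : Type*} [AddCommGroup V] [Module ℝ V]

/-- The exterior product of a linear functional with an alternating form. -/
def wedgeFunctional (Φ : V [⋀^Fin p]→ₗ[ℝ] ℝ) (ω : V →ₗ[ℝ] ℝ) : V [⋀^Fin (p + 1)]→ₗ[ℝ] ℝ :=
  AlternatingMap.alternatizeUncurryFin (ω.smulRight Φ)

lemma wedgeFunctional_apply (Φ : V [⋀^Fin p]→ₗ[ℝ] ℝ) (ω : V →ₗ[ℝ] ℝ) (v : Fin (p + 1) → V) :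
    wedgeFunctional Φ ω v =
      ∑ i : Fin (p + 1), (-1) ^ (i : ℕ) * (ω (v i) * Φ (i.removeNth v)) := by
  simp [wedgeFunctional, AlternatingMap.alternatizeUncurryFin_apply, zsmul_eq_mul]

lemma wedgeFunctional_add_smul (Φ : V [⋀^Fin p]→ₗ[ℝ] ℝ) (ω lam : V →ₗ[ℝ] ℝ) (s : ℝ)
    (v : Fin (p + 1) → V) :
    wedgeFunctional Φ (ω + s • lam) v =
      wedgeFunctional Φ ω v + s * wedgeFunctional Φ lam v := by
  simp only [wedgeFunctional_apply, Finset.mul_sum, ← Finset.sum_add_distrib]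
  refine Finset.sum_congr rfl fun i _ => ?_
  simp
  ring

open Classical in
/-- The flags of flats of ranks `1, …, p`. -/
def flatFlags (M : Matroid (Fin n)) (p : ℕ) : Finset (Fin p → Set (Fin n)) :=
  Finset.univ.filter fun f => IsFlatFlag M p f

lemma mem_flatFlags {f : Fin p → Set (Fin n)} : f ∈ flatFlags M p ↔ IsFlatFlag M p f := by
  classical
  simp [flatFlags]

lemma removeNth_update_self {α : Type*} (i : Fin (p + 1)) (f : Fin (p + 1) → α) (x : α) :
    i.removeNth (update f i x) = i.removeNth f := by
  ext j
  simp [Fin.removeNth, Fin.succAbove_ne]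

open Classical in
/-- The balancing condition: an alternating form sums to zero over all flags with a prescribed
facet. -/
lemma sum_flatFlags_removeNth_eq (hE : M.E = Set.univ) (h0 : M.IsFlat ∅) (e : Fin n → V)
    (hsum : ∑ i, e i = 0) (Ψ : V [⋀^Fin (p + 1)]→ₗ[ℝ] ℝ) (i : Fin (p + 1))
    (g : Fin p → Set (Fin n)) :
    ∑ f ∈ flatFlags M (p + 1) with i.removeNth f = g, Ψ (eVec e ∘ f) = 0 := by
  by_cases hex : ∃ f ∈ flatFlags M (p + 1), i.removeNth f = g
  swap
  · refine Finset.sum_eq_zero fun f hf => absurd ⟨f, Finset.mem_filter.1 hf⟩ hex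
  obtain ⟨f₀, hf₀, hg⟩ := hex
  have hf := mem_flatFlags.1 hf₀
  have hi : (i : ℕ) ≤ p + 1 := i.2.le
  have key := hf.sum_map_update_flatCovers hE h0 e Ψ i (hf.isFlat_upperFlat hE i)
    ((lowerFlat_subset hf.mono i).trans (subset_upperFlat hf.mono i))
  rw [hf.map_update_upperFlat e hsum] at key
  rw [← key]
  symm
  refine Finset.sum_nbij' (fun G => update f₀ i G) (fun f => f i) ?_ ?_ ?_ ?_ ?_
  · intro G hG
    refine Finset.mem_filter.2 ⟨mem_flatFlags.2 ?_, (removeNth_update_self i f₀ G).trans hg⟩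
    have := hf.update_of_mem_flatCovers hi subset_rfl hG
    rwa [max_eq_left (by omega)] at this
  · intro f hf'
    obtain ⟨hf', hfi⟩ := Finset.mem_filter.1 hf'
    have hf' := mem_flatFlags.1 hf'
    have hj : ∀ j, j ≠ i → f j = f₀ j := by
      intro j hj
      obtain ⟨k, rfl⟩ := Fin.exists_succAbove_eq hj
      exact congrFun (hfi.trans hg.symm) k
    refine mem_flatCovers.2 ⟨hf'.isFlat i, ?_, ?_, ?_⟩
    · rw [hf'.eRk_eq i i.2, hf.eRk_lowerFlat hi]
    · refine Set.iUnion₂_subset fun j hji => ?_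
      rw [← hj j hji.ne]
      exact hf'.mono hji.le
    · refine Set.subset_iInter₂ fun j hji => ?_
      rw [← hj j (ne_of_gt hji)]
      exact hf'.mono (le_of_lt hji)
  · intro G _
    simp
  · intro f hf'
    obtain ⟨-, hfi⟩ := Finset.mem_filter.1 hf'
    ext1 j
    by_cases hj : j = i
    · subst hj; simp
    · rw [update_of_ne hj]
      obtain ⟨k, rfl⟩ := Fin.exists_succAbove_eq hj
      exact (congrFun (hfi.trans hg.symm) k).symm
  · intro G _
    rfl

/-- The localized pairing of a form divisible by `ω` with any other form vanishes. -/
lemma sum_wedgeFunctional_mul_div (hE : M.E = Set.univ) (h0 : M.IsFlat ∅) (e : Fin n → V)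
    (hsum : ∑ i, e i = 0) (Φ : V [⋀^Fin p]→ₗ[ℝ] ℝ) (Ψ : V [⋀^Fin (p + 1)]→ₗ[ℝ] ℝ)
    (ω : V →ₗ[ℝ] ℝ) (hω : ∀ f ∈ flatFlags M (p + 1), ∀ i, ω (eVec e (f i)) ≠ 0) :
    ∑ f ∈ flatFlags M (p + 1), wedgeFunctional Φ ω (eVec e ∘ f) * Ψ (eVec e ∘ f) /
      ∏ i, ω (eVec e (f i)) = 0 := by
  classical
  have hterm : ∀ f ∈ flatFlags M (p + 1),
      wedgeFunctional Φ ω (eVec e ∘ f) * Ψ (eVec e ∘ f) / ∏ i, ω (eVec e (f i)) =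
      ∑ i : Fin (p + 1), ((-1) ^ (i : ℕ) * (Φ (eVec e ∘ i.removeNth f) /
        ∏ j, ω (eVec e (i.removeNth f j)))) * Ψ (eVec e ∘ f) := by
    intro f hf
    rw [wedgeFunctional_apply, Finset.sum_mul, Finset.sum_div]
    refine Finset.sum_congr rfl fun i _ => ?_
    have h1 := hω f hf i
    have h2 : ∏ j, ω (eVec e (i.removeNth f j)) ≠ 0 :=
      Finset.prod_ne_zero_iff.2 fun j _ => hω f hf _
    have h3 : i.removeNth (eVec e ∘ f) = eVec e ∘ i.removeNth f := rfl
    rw [Fin.prod_univ_succAbove _ i, h3]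
    change _ / (_ * ∏ j, ω (eVec e (i.removeNth f j))) = _
    simp only [Function.comp_apply]
    field_simp
  rw [Finset.sum_congr rfl hterm, Finset.sum_comm]
  refine Finset.sum_eq_zero fun i _ => ?_
  rw [← Finset.sum_fiberwise (flatFlags M (p + 1)) (fun f => i.removeNth f)]
  refine Finset.sum_eq_zero fun g _ => ?_
  have hg : ∀ f ∈ (flatFlags M (p + 1)).filter (fun f => i.removeNth f = g),
      ((-1) ^ (i : ℕ) * (Φ (eVec e ∘ i.removeNth f) /
        ∏ j, ω (eVec e (i.removeNth f j)))) * Ψ (eVec e ∘ f) =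
      ((-1) ^ (i : ℕ) * (Φ (eVec e ∘ g) / ∏ j, ω (eVec e (g j)))) * Ψ (eVec e ∘ f) := by
    intro f hf
    rw [(Finset.mem_filter.1 hf).2]
  rw [Finset.sum_congr rfl hg, ← Finset.mul_sum, sum_flatFlags_removeNth_eq hE h0 e hsum,
    mul_zero]

/-- If every facet of every flag with a member on which `ω` is positive is killed by `Φ`,
then the product of `ω` and `Φ` vanishes on all flags. -/
lemma wedgeFunctional_eq_zero (hE : M.E = Set.univ) (h0 : M.IsFlat ∅) (e : Fin n → V)
    (hsum : ∑ i, e i = 0) (Φ : V [⋀^Fin p]→ₗ[ℝ] ℝ) (ω : V →ₗ[ℝ] ℝ)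
    (hω : ∀ f ∈ flatFlags M (p + 1), ∀ i, ω (eVec e (f i)) ≠ 0)
    (hΦ : ∀ f ∈ flatFlags M (p + 1), ∀ i, 0 < ω (eVec e (f i)) →
      ∀ j : Fin (p + 1), Φ (eVec e ∘ j.removeNth f) = 0)
    {f : Fin (p + 1) → Set (Fin n)} (hf : f ∈ flatFlags M (p + 1)) :
    wedgeFunctional Φ ω (eVec e ∘ f) = 0 := by
  have hpos : ∀ f ∈ flatFlags M (p + 1), ∀ i, 0 < ω (eVec e (f i)) →
      wedgeFunctional Φ ω (eVec e ∘ f) = 0 := by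
    intro f hf i hi
    rw [wedgeFunctional_apply]
    refine Finset.sum_eq_zero fun j _ => ?_
    have h3 : j.removeNth (eVec e ∘ f) = eVec e ∘ j.removeNth f := rfl
    rw [h3, hΦ f hf i hi j, mul_zero, mul_zero]
  have hB := sum_wedgeFunctional_mul_div hE h0 e hsum Φ (wedgeFunctional Φ ω) ω hω
  have hB' : ∑ f ∈ flatFlags M (p + 1),
      wedgeFunctional Φ ω (eVec e ∘ f) ^ 2 / ∏ i, -ω (eVec e (f i)) = 0 := by
    rw [← mul_eq_zero_of_right ((-1 : ℝ) ^ (p + 1)) hB, Finset.mul_sum]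
    refine Finset.sum_congr rfl fun f _ => ?_
    rw [Finset.prod_neg, Finset.card_univ, Fintype.card_fin, sq, div_mul_eq_div_div_swap,
      mul_comm, div_eq_mul_inv _ ((-1 : ℝ) ^ (p + 1)), ← inv_pow, inv_neg_one, mul_comm]
  have hneg : ∀ f ∈ flatFlags M (p + 1), wedgeFunctional Φ ω (eVec e ∘ f) ≠ 0 →
      0 < ∏ i, -ω (eVec e (f i)) := by
    intro f hf hne
    refine Finset.prod_pos fun i _ => ?_
    rcases lt_trichotomy (ω (eVec e (f i))) 0 with h | h | h
    · linarith
    · exact absurd h (hω f hf i)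
    · exact absurd (hpos f hf i h) hne
  rw [Finset.sum_eq_zero_iff_of_nonneg] at hB'
  · by_contra hne
    have h := hB' f hf
    rw [div_eq_zero_iff] at h
    rcases h with h | h
    · exact hne (pow_eq_zero_iff two_ne_zero |>.1 h)
    · exact (hneg f hf hne).ne' h
  · intro f hf
    by_cases hne : wedgeFunctional Φ ω (eVec e ∘ f) = 0
    · simp [hne]
    · exact div_nonneg (sq_nonneg _) (hneg f hf hne).le

/-- Small perturbations of a linear functional keep its signs at finitely many vectors. -/
lemma exists_smul_perturbation {ι : Type*} [Finite ι] (x : ι → V) (ω lam : V →ₗ[ℝ] ℝ) :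
    ∃ s : ℝ, s ≠ 0 ∧ ∀ i, ω (x i) ≠ 0 → 0 < ω (x i) * (ω + s • lam) (x i) := by
  have h : ∀ᶠ s : ℝ in nhds 0, ∀ i, ω (x i) ≠ 0 → 0 < ω (x i) * (ω + s • lam) (x i) := by
    rw [Filter.eventually_all]
    intro i
    by_cases hi : ω (x i) = 0
    · exact Filter.Eventually.of_forall fun s h => absurd hi h
    · have hc : Continuous fun s : ℝ => ω (x i) * (ω + s • lam) (x i) := by
        simp only [LinearMap.add_apply, LinearMap.smul_apply, smul_eq_mul]
        fun_prop
      have h0 : 0 < ω (x i) * (ω + (0 : ℝ) • lam) (x i) := by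
        simpa using mul_self_pos.2 hi
      filter_upwards [hc.continuousAt.eventually (lt_mem_nhds h0)] with s hs _ using hs
  obtain ⟨s, hs, hs0⟩ := ((h.filter_mono nhdsWithin_le_nhds).and
    (self_mem_nhdsWithin : {(0 : ℝ)}ᶜ ∈ nhdsWithin 0 {0}ᶜ)).exists
  exact ⟨s, hs0, hs⟩

/-- Under the hypotheses of `wedgeFunctional_eq_zero`, the product of `Φ` with every linear
functional vanishes on all flags. -/
lemma wedgeFunctional_eq_zero_of_generic (hE : M.E = Set.univ) (h0 : M.IsFlat ∅)
    (e : Fin n → V) (hsum : ∑ i, e i = 0) (Φ : V [⋀^Fin p]→ₗ[ℝ] ℝ) (ω lam : V →ₗ[ℝ] ℝ)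
    (hω : ∀ f ∈ flatFlags M (p + 1), ∀ i, ω (eVec e (f i)) ≠ 0)
    (hΦ : ∀ f ∈ flatFlags M (p + 1), ∀ i, 0 < ω (eVec e (f i)) →
      ∀ j : Fin (p + 1), Φ (eVec e ∘ j.removeNth f) = 0)
    {f : Fin (p + 1) → Set (Fin n)} (hf : f ∈ flatFlags M (p + 1)) :
    wedgeFunctional Φ lam (eVec e ∘ f) = 0 := by
  obtain ⟨s, hs, hsgn⟩ := exists_smul_perturbation (fun S : Set (Fin n) => eVec e S) ω lam
  have h1 := wedgeFunctional_eq_zero hE h0 e hsum Φ ω hω hΦ hf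
  have h2 := wedgeFunctional_eq_zero hE h0 e hsum Φ (ω + s • lam)
    (fun f hf i h => by have := hsgn (f i) (hω f hf i); simp [h] at this)
    (fun f hf i h => hΦ f hf i (pos_of_mul_pos_left (hsgn (f i) (hω f hf i)) h.le)) hf
  rw [wedgeFunctional_add_smul, h1, zero_add] at h2
  exact (mul_eq_zero.1 h2).resolve_left hs

end WedgeWithFunctional

section Duality

variable {n p : ℕ} {M : Matroid (Fin n)} {V : Type*} [AddCommGroup V] [Module ℝ V]

lemma exists_functional_eq_one (e : Fin n → V)
    (hind : ∀ s : Finset (Fin n), s ≠ Finset.univ → LinearIndependent ℝ (fun i : ↥s => e ↑i))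
    {x y : Fin n} (hxy : x ≠ y) :
    ∃ lam : V →ₗ[ℝ] ℝ, lam (e x) = 1 ∧ ∀ i, i ≠ x → i ≠ y → lam (e i) = 0 := by
  have hs : Finset.univ.erase y ≠ Finset.univ := fun h => by
    have := h ▸ Finset.mem_univ y
    simp at this
  have hli := hind _ hs
  have hmem : ∀ i, i ≠ y → i ∈ Finset.univ.erase y := fun i hi => by simp [hi]
  obtain ⟨lam, hlam⟩ := LinearMap.exists_extend
    ((Finsupp.lapply (⟨x, hmem x hxy⟩ : ↥(Finset.univ.erase y))).comp hli.repr)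
  have hval : ∀ (i : Fin n) (hi : i ≠ y), lam (e i) =
      Finsupp.single (⟨i, hmem i hi⟩ : ↥(Finset.univ.erase y)) (1 : ℝ) ⟨x, hmem x hxy⟩ := by
    intro i hi
    have hin : e i ∈ Submodule.span ℝ (Set.range fun i : ↥(Finset.univ.erase y) => e ↑i) :=
      Submodule.subset_span ⟨⟨i, hmem i hi⟩, rfl⟩
    have h := LinearMap.congr_fun hlam ⟨e i, hin⟩
    simp only [LinearMap.comp_apply, Submodule.subtype_apply,
      Finsupp.lapply_apply] at h
    rw [h, hli.repr_eq_single ⟨i, hmem i hi⟩ ⟨e i, hin⟩ rfl]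
  refine ⟨lam, by rw [hval x hxy, Finsupp.single_eq_same], fun i hix hiy => ?_⟩
  rw [hval i hiy, Finsupp.single_eq_of_ne]
  simpa using hix.symm

lemma map_eVec_eq_zero {e : Fin n → V} {lam : V →ₗ[ℝ] ℝ} {S : Set (Fin n)}
    (h : ∀ i ∈ S, lam (e i) = 0) : lam (eVec e S) = 0 := by
  classical
  rw [eVec_eq_sum, map_sum]
  refine Finset.sum_eq_zero fun i _ => ?_
  split_ifs with hi
  · exact h i hi
  · exact map_zero lam

lemma map_eVec_eq_one {e : Fin n → V} {lam : V →ₗ[ℝ] ℝ} {S : Set (Fin n)} {x : Fin n}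
    (hx : x ∈ S) (h1 : lam (e x) = 1) (h : ∀ i ∈ S, i ≠ x → lam (e i) = 0) :
    lam (eVec e S) = 1 := by
  classical
  rw [eVec_eq_sum, map_sum, Finset.sum_eq_single x]
  · rw [if_pos hx, h1]
  · intro i _ hi
    split_ifs with hiS
    · exact h i hiS hi
    · exact map_zero lam
  · simp

/-- A flag of flats of ranks `1, …, p` extends to one of ranks `1, …, p + 1`, whose last member
contains an element outside the other members. -/
lemma IsFlatFlag.exists_extend (hE : M.E = Set.univ) (h0 : M.IsFlat ∅)
    {g : Fin p → Set (Fin n)} (hg : IsFlatFlag M p g) (hp : (p : ℕ∞) < M.eRk Set.univ) :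
    ∃ f : Fin (p + 1) → Set (Fin n), IsFlatFlag M (p + 1) f ∧ (Fin.last p).removeNth f = g ∧
      ∃ x ∈ f (Fin.last p), ∀ i, x ∉ g i := by
  set h : Fin (p + 1) → Set (Fin n) := Fin.snoc (α := fun _ => Set (Fin n)) g Set.univ with hh
  have hcast : ∀ i : Fin p, h i.castSucc = g i := fun i => by simp [hh]
  have hlast : h (Fin.last p) = Set.univ := by simp [hh]
  have hflag : IsFlatFlag M p h := by
    refine ⟨fun i => ?_, fun i j hij => ?_, fun i hi => ?_⟩
    · induction i using Fin.lastCases with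
      | last => rw [hlast]; exact isFlat_univ hE
      | cast i => rw [hcast]; exact hg.isFlat i
    · induction j using Fin.lastCases with
      | last => rw [hlast]; exact Set.subset_univ _
      | cast j =>
        induction i using Fin.lastCases with
        | last => exact absurd hij (not_le.2 (Fin.castSucc_lt_last j))
        | cast i => rw [hcast, hcast]; exact hg.mono (Fin.castSucc_le_castSucc_iff.1 hij)
    · induction i using Fin.lastCases with
      | last => simp at hi
      | cast i => rw [hcast]; exact hg.eRk_eq i i.2
  set A := lowerFlat h (Fin.last p) with hA
  have hAflat : M.IsFlat A := hflag.isFlat_lowerFlat h0 _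
  have hAr : M.eRk A = p := hflag.eRk_lowerFlat (by simp)
  have hAne : A ≠ Set.univ := fun h' => by
    rw [← h', hAr] at hp
    exact hp.false
  obtain ⟨x, hx⟩ := (Set.ne_univ_iff_exists_notMem A).1 hAne
  have hF := closure_insert_mem_flatCovers hE hAflat (isFlat_univ hE) (Set.subset_univ A)
    (Set.mem_univ x) hx
  have hf := hflag.update_of_mem_flatCovers (i := Fin.last p) (by simp)
    (upperFlat_of_last h (by simp)).ge hF
  refine ⟨_, by simpa using hf, ?_, x, ?_, fun i hi => hx ?_⟩
  · rw [removeNth_update_self]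
    ext1 i
    simp [Fin.removeNth, hcast]
  · rw [update_self]
    exact subset_closure_insert hE A x (Set.mem_insert _ _)
  · rw [← hcast] at hi
    exact Set.mem_iUnion₂.2 ⟨i.castSucc, Fin.castSucc_lt_last i, hi⟩

/-- If every facet of every flag of length `p + 1` with an `ω`-positive member is killed by `Φ`,
then `Φ` vanishes on all multichains of `p` flats. -/
lemma map_eq_zero_of_forall_positive_flag (hE : M.E = Set.univ) (h0 : M.IsFlat ∅)
    (e : Fin n → V) (hsum : ∑ i, e i = 0)
    (hind : ∀ s : Finset (Fin n), s ≠ Finset.univ → LinearIndependent ℝ (fun i : ↥s => e ↑i))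
    (hp : ((p + 1 : ℕ) : ℕ∞) < M.eRk Set.univ) (Φ : V [⋀^Fin p]→ₗ[ℝ] ℝ) (ω : V →ₗ[ℝ] ℝ)
    (hω : ∀ f ∈ flatFlags M (p + 1), ∀ i, ω (eVec e (f i)) ≠ 0)
    (hΦ : ∀ f ∈ flatFlags M (p + 1), ∀ i, 0 < ω (eVec e (f i)) →
      ∀ j : Fin (p + 1), Φ (eVec e ∘ j.removeNth f) = 0)
    {g : Fin p → Set (Fin n)} (hg : IsFlatFlag M 0 g) : Φ (eVec e ∘ g) = 0 := by
  refine IsFlatFlag.map_eq_zero_of_forall_flag hE h0 e Φ (fun g hg => ?_) (Nat.zero_le p) hg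
  obtain ⟨f, hf, rfl, x, hxf, hxg⟩ := hg.exists_extend hE h0
    (lt_of_le_of_lt (by exact_mod_cast Nat.le_succ p) hp)
  have hne : f (Fin.last p) ≠ Set.univ := fun h => by
    have := hf.eRk_eq (Fin.last p) (by simp)
    rw [h] at this
    rw [this] at hp
    simp at hp
  obtain ⟨y, hy⟩ := (Set.ne_univ_iff_exists_notMem _).1 hne
  have hxy : x ≠ y := fun h => hy (h ▸ hxf)
  obtain ⟨lam, hx1, hlam⟩ := exists_functional_eq_one e hind hxy
  have hyi : ∀ i, y ∉ f i := fun i h => hy (hf.mono (Fin.le_last i) h)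
  have h := wedgeFunctional_eq_zero_of_generic hE h0 e hsum Φ ω lam hω hΦ (mem_flatFlags.2 hf)
  rw [wedgeFunctional_apply, Finset.sum_eq_single (Fin.last p)] at h
  · have h1 : lam (eVec e (f (Fin.last p))) = 1 :=
      map_eVec_eq_one hxf hx1 fun i hi hix => hlam i hix fun h => hy (h ▸ hi)
    have h3 : (Fin.last p).removeNth (eVec e ∘ f) = eVec e ∘ (Fin.last p).removeNth f := rfl
    rw [Function.comp_apply, h1, one_mul, h3] at h
    exact (mul_eq_zero.1 h).resolve_left (pow_ne_zero _ (by norm_num))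
  · intro i _ hi
    obtain ⟨k, rfl⟩ := Fin.exists_succAbove_eq hi
    have : lam (eVec e (f ((Fin.last p).succAbove k))) = 0 :=
      map_eVec_eq_zero fun i hi => hlam i (fun h => hxg k (h ▸ hi)) fun h => hyi _ (h ▸ hi)
    rw [Function.comp_apply, this, zero_mul, mul_zero]
  · simp

end Duality

section Cones

variable {n p : ℕ} {V : Type*} [AddCommGroup V] [Module ℝ V]

lemma subset_posSpan (s : Set V) : s ⊆ posSpan s := fun v hv =>
  ⟨{v}, fun _ => 1, by simpa using hv, fun _ => zero_le_one, by simp⟩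

lemma add_smul_mem_posSpan {s : Set V} {v w : V} (hv : v ∈ s) (hw : w ∈ s) (hne : v ≠ w)
    {t : ℝ} (ht : 0 ≤ t) : v + t • w ∈ posSpan s := by
  classical
  refine ⟨{v, w}, fun u => if u = v then 1 else t, ?_, fun u => ?_, ?_⟩
  · simp [Set.insert_subset_iff, hv, hw]
  · dsimp only
    split_ifs
    · exact zero_le_one
    · exact ht
  · simp [Finset.sum_pair hne, hne.symm]

lemma posSpan_subset_span (s : Set V) : posSpan s ⊆ Submodule.span ℝ s := by
  rintro x ⟨T, c, hT, -, rfl⟩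
  exact Submodule.sum_mem _ fun v hv => Submodule.smul_mem _ _ (Submodule.subset_span (hT hv))

/-- A cone with a generator on which `ω` is positive is spanned by its intersection with the
halfspace `0 ≤ ω`. -/
lemma mem_span_posSpan_inter {s : Set V} (ω : V →ₗ[ℝ] ℝ) {v w : V} (hv : v ∈ s) (hw : w ∈ s)
    (hpos : 0 < ω w) : v ∈ Submodule.span ℝ (posSpan s ∩ {x | 0 ≤ ω x}) := by
  have hw' : w ∈ Submodule.span ℝ (posSpan s ∩ {x | 0 ≤ ω x}) :=
    Submodule.subset_span ⟨subset_posSpan s hw, hpos.le⟩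
  by_cases hne : v = w
  · rwa [hne]
  · have ht : 0 ≤ |ω v| / ω w := by positivity
    have h : v + (|ω v| / ω w) • w ∈ Submodule.span ℝ (posSpan s ∩ {x | 0 ≤ ω x}) := by
      refine Submodule.subset_span ⟨add_smul_mem_posSpan hv hw hne ht, ?_⟩
      simp only [Set.mem_ofPred_eq, map_add, map_smul, smul_eq_mul]
      rw [div_mul_cancel₀ _ hpos.ne']
      linarith [neg_abs_le (ω v)]
    simpa using Submodule.sub_mem _ h (Submodule.smul_mem _ (|ω v| / ω w) hw')

lemma AlternatingMap.eq_zero_of_mem_span (Φ : V [⋀^Fin p]→ₗ[ℝ] ℝ) {s : Set V}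
    (hΦ : ∀ v : Fin p → V, (∀ i, v i ∈ s) → Φ v = 0) {v : Fin p → V}
    (hv : ∀ i, v i ∈ Submodule.span ℝ s) : Φ v = 0 := by
  suffices h : ∀ (T : Finset (Fin p)) (v : Fin p → V), (∀ i ∈ T, v i ∈ Submodule.span ℝ s) →
      (∀ i ∉ T, v i ∈ s) → Φ v = 0 from
    h Finset.univ v (fun i _ => hv i) (fun i hi => absurd (Finset.mem_univ i) hi)
  intro T
  induction T using Finset.induction_on with
  | empty => exact fun v _ h => hΦ v fun i => h i (Finset.notMem_empty i)
  | insert a T ha ih =>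
    intro v hT hs
    have key : ∀ x ∈ Submodule.span ℝ s, Φ (update v a x) = 0 := by
      intro x hx
      induction hx using Submodule.span_induction with
      | mem x hx =>
        refine ih _ (fun i hi => ?_) fun i hi => ?_
        · rw [update_of_ne (ne_of_mem_of_not_mem hi ha)]
          exact hT i (Finset.mem_insert_of_mem hi)
        · by_cases h : i = a
          · subst h; rwa [update_self]
          · rw [update_of_ne h]
            exact hs i (by simp [h, hi])
      | zero => exact Φ.map_update_zero _ _
      | add x y _ _ hx hy => rw [Φ.map_update_add, hx, hy, add_zero]
      | smul c x _ hx => rw [Φ.map_update_smul, hx, smul_zero]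
    have := key (v a) (hT a (Finset.mem_insert_self a T))
    rwa [update_eq_self] at this

end Cones

section Chains

variable {n p : ℕ} {M : Matroid (Fin n)}

/-- A family of flats from a chain can be sorted into a multichain. -/
lemma exists_perm_isFlatFlag {C : Set (Set (Fin n))} (hC : IsChain (· ⊆ ·) C)
    (hflat : ∀ F ∈ C, M.IsFlat F) {f : Fin p → Set (Fin n)} (hf : ∀ i, f i ∈ C) :
    ∃ σ : Equiv.Perm (Fin p), IsFlatFlag M 0 (f ∘ σ) := by
  refine ⟨Tuple.sort fun i => (f i).ncard, fun i => hflat _ (hf _), fun i j hij => ?_,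
    fun i hi => absurd hi (Nat.not_lt_zero _)⟩
  have hcard := Tuple.monotone_sort (fun i => (f i).ncard) hij
  rcases hC.total (hf (Tuple.sort (fun i => (f i).ncard) i))
    (hf (Tuple.sort (fun i => (f i).ncard) j)) with h | h
  · exact h
  · exact (Set.eq_of_subset_of_ncard_le h hcard (Set.toFinite _)).ge

lemma coe_mrk (M : Matroid (Fin n)) (X : Set (Fin n)) : (mrk M X : ℕ∞) = M.eRk X := by
  obtain ⟨I, hI⟩ := M.exists_isBasis' X
  have hIr : (I.ncard : ℕ∞) = M.eRk X := by
    rw [← hI.encard_eq_eRk, (Set.toFinite I).cast_ncard_eq]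
  have hgreatest : IsGreatest {k | ∃ I, M.Indep I ∧ I ⊆ X ∧ I.ncard = k} I.ncard := by
    refine ⟨⟨I, hI.indep, hI.subset, rfl⟩, ?_⟩
    rintro k ⟨J, hJ, hJX, rfl⟩
    have h := hJ.encard_le_eRk_of_subset hJX
    rw [← hIr, ← (Set.toFinite J).cast_ncard_eq] at h
    exact_mod_cast h
  rw [mrk, hgreatest.csSup_eq, hIr]

/-- The members of a flag of flats of ranks `1, …, p < rank M` are proper nonempty flats. -/
lemma IsFlatFlag.mem_properFlats {f : Fin p → Set (Fin n)} (hf : IsFlatFlag M p f)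
    (hp : (p : ℕ∞) < M.eRk Set.univ) (i : Fin p) : f i ∈ properFlats M := by
  have hr := hf.eRk_eq i i.2
  refine ⟨(hf.isFlat i).closure, Set.nonempty_iff_ne_empty.2 fun h => ?_, fun h => ?_⟩
  · rw [h, M.eRk_empty] at hr
    exact absurd hr.symm (by norm_cast)
  · rw [← h, hr] at hp
    have : p < (i : ℕ) + 1 := by exact_mod_cast hp
    omega

end Chains

/-- **Framings can be pushed into a halfspace.** Let `M` be a loopless matroid of
rank `r ≥ 2`, `B(M) ⊆ ℝ^{n-1}` its Bergman fan, and `H⁺` a general position closed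
halfspace through the origin.  Then for every `p ≤ r - 2`, the `p`-group of
`B(M) ∩ H⁺` (spanned by wedges of vectors in the spans of the sets `pos(C) ∩ H⁺`)
equals the `p`-group of `B(M)`. -/
theorem pGroup_of_halfspace_eq
    {n r : ℕ} (M : Matroid (Fin n)) (hE : M.E = Set.univ)
    (hLoopless : M.closure ∅ = ∅)
    (hrank : mrk M Set.univ = r) (hr : 2 ≤ r)
    (e : Fin n → EuclideanSpace ℝ (Fin (n - 1)))
    (hsum : ∑ i, e i = 0)
    (hind : ∀ s : Finset (Fin n), s ≠ Finset.univ →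
      LinearIndependent ℝ (fun i : ↥s => e ↑i))
    (ν : EuclideanSpace ℝ (Fin (n - 1)))
    (hν : ∀ σ : Set (Fin n), σ.Nonempty → σ ≠ Set.univ → ⟪ν, eVec e σ⟫ ≠ 0)
    (p : ℕ) (hp : p ≤ r - 2) :
    pGroup p
        {K | ∃ C : Set (Set (Fin n)), C ⊆ properFlats M ∧ IsChain (· ⊆ ·) C ∧
          K = posSpan (eVec e '' C) ∩ {x | 0 ≤ ⟪ν, x⟫}} =
      pGroup p
        {K | ∃ C : Set (Set (Fin n)), C ⊆ properFlats M ∧ IsChain (· ⊆ ·) C ∧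
          K = posSpan (eVec e '' C)} := by
  have h0 : M.IsFlat ∅ := Matroid.isFlat_iff_closure_eq.2 hLoopless
  have hp' : ((p + 1 : ℕ) : ℕ∞) < M.eRk Set.univ := by
    rw [← coe_mrk, hrank]
    exact_mod_cast (by omega : p + 1 < r)
  refine le_antisymm (Submodule.span_mono ?_) (Submodule.span_le.2 ?_)
  · rintro w ⟨v, _, ⟨C, hC, hchain, rfl⟩, hv, rfl⟩
    exact ⟨v, _, ⟨C, hC, hchain, rfl⟩,
      fun i => Submodule.span_mono Set.inter_subset_left (hv i), rfl⟩
  rintro w ⟨v, _, ⟨C, hC, hchain, rfl⟩, hv, rfl⟩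
  by_contra hw
  obtain ⟨φ, hφw, hφ⟩ := Submodule.exists_le_ker_of_notMem hw
  set Φ : EuclideanSpace ℝ (Fin (n - 1)) [⋀^Fin p]→ₗ[ℝ] ℝ :=
    φ.compAlternatingMap (ExteriorAlgebra.ιMulti ℝ p) with hΦdef
  have hΦ : ∀ v, Φ v = φ (List.ofFn fun i => ExteriorAlgebra.ι ℝ (v i)).prod := fun v => by
    rw [hΦdef, LinearMap.compAlternatingMap_apply, ExteriorAlgebra.ιMulti_apply]
  have hmem : ∀ f ∈ flatFlags M (p + 1), ∀ i, f i ∈ properFlats M := fun f hf =>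
    (mem_flatFlags.1 hf).mem_properFlats hp'
  have hpos : ∀ f ∈ flatFlags M (p + 1), ∀ i, 0 < (innerₗ _ ν) (eVec e (f i)) →
      ∀ j : Fin (p + 1), Φ (eVec e ∘ j.removeNth f) = 0 := by
    intro f hf i hi j
    rw [hΦ]
    refine hφ (Submodule.subset_span ⟨_, _, ⟨Set.range f, ?_, ?_, rfl⟩, fun k => ?_, rfl⟩)
    · rintro _ ⟨i, rfl⟩
      exact hmem f hf i
    · exact (mem_flatFlags.1 hf).mono.isChain_range
    · exact mem_span_posSpan_inter (innerₗ _ ν) (Set.mem_image_of_mem _ (Set.mem_range_self _))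
        (Set.mem_image_of_mem _ (Set.mem_range_self i)) hi
  have hflag : ∀ g : Fin p → Set (Fin n), IsFlatFlag M 0 g → Φ (eVec e ∘ g) = 0 := fun g hg =>
    map_eq_zero_of_forall_positive_flag hE h0 e hsum hind hp' Φ (innerₗ _ ν)
      (fun f hf i => hν _ (hmem f hf i).2.1 (hmem f hf i).2.2) hpos hg
  refine hφw ((hΦ v).symm.trans (AlternatingMap.eq_zero_of_mem_span Φ (s := eVec e '' C) ?_
    fun i => Submodule.span_le.2 (posSpan_subset_span _) (hv i)))
  intro v hv
  choose f hfC hfv using hv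
  obtain rfl : eVec e ∘ f = v := funext hfv
  obtain ⟨σ, hσ⟩ := exists_perm_isFlatFlag hchain
    (fun F hF => Matroid.isFlat_iff_closure_eq.2 (hC hF).1) hfC
  have h := hflag _ hσ
  rw [← Function.comp_assoc, Φ.map_perm] at h
  exact (smul_eq_zero_iff_eq _).1 h
end
end
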